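/- Let a,b>0, p>6 and let h satisfy (h₁) and (h₂), with λ≥λ₀ as in the compactness lemma. If u∈M_λ satisfies J_λ(u)=m_λ, then u is a sign-changing solution of the equation: for every x∈ℤ³, −(a+b∑_{y∈ℤ³}|∇u|²(y))Δu(x)+(λh(x)+1)u(x)=|u(x)|^{p−2}u(x)·log(u(x)²). Moreover m_λ>2c_λ. -/

import Mathlib

open scoped BigOperators
open Filter

namespace DiscreteKirchhoff

/-- Vertices of the lattice graph ℤ³. -/
abbrev V := Fin 3 → ℤ

/-- Adjacency on ℤ³: x ∼ y iff ∑ᵢ |xᵢ - yᵢ| = 1. -/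
def adj (x y : V) : Prop := (∑ i, |x i - y i|) = 1

instance (x y : V) : Decidable (adj x y) :=
  inferInstanceAs (Decidable ((∑ i, |x i - y i|) = 1))

/-- Graph Laplacian: Δu(x) = ∑_{y∼x} (u(y) - u(x)). -/
noncomputable def lap (u : V → ℝ) (x : V) : ℝ :=
  ∑' y : V, if adj x y then u y - u x else 0

/-- Gradient form: ∇u∇v(x) = (1/2) ∑_{y∼x} (u(y)-u(x))(v(y)-v(x)). -/
noncomputable def gradForm (u v : V → ℝ) (x : V) : ℝ :=
  (1/2) * ∑' y : V, if adj x y then (u y - u x) * (v y - v x) else 0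

/-- |∇u|²(x). -/
noncomputable def gradSq (u : V → ℝ) (x : V) : ℝ := gradForm u u x

/-- Positive part u⁺ = max(u,0). -/
noncomputable def pos (u : V → ℝ) : V → ℝ := fun x => max (u x) 0

/-- Negative part u⁻ = min(u,0). -/
noncomputable def neg (u : V → ℝ) : V → ℝ := fun x => min (u x) 0

/-- K_V(u) = ∑_x ∑_{y∼x} [u⁺(x)u⁻(y) + u⁻(x)u⁺(y)]. -/
noncomputable def KV (u : V → ℝ) : ℝ :=
  ∑' x : V, ∑' y : V, if adj x y then pos u x * neg u y + neg u x * pos u y else 0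

/-- |t|^p log t², taken to be 0 at t = 0. -/
noncomputable def logTerm (p t : ℝ) : ℝ :=
  if t = 0 then 0 else |t| ^ p * Real.log (t ^ 2)

/-- |t|^{p-2} t log t², taken to be 0 at t = 0. -/
noncomputable def nlTerm (p t : ℝ) : ℝ :=
  if t = 0 then 0 else |t| ^ (p - 2) * t * Real.log (t ^ 2)

/-- Membership in the space ℋ_λ (independent of λ > 0). -/
def memH (h u : V → ℝ) : Prop :=
  Summable (fun x => gradSq u x + (u x) ^ 2) ∧ Summable (fun x => h x * (u x) ^ 2)

/-- h_λ(x) = λ h(x) + 1. -/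
noncomputable def hl (lam : ℝ) (h : V → ℝ) (x : V) : ℝ := lam * h x + 1

/-- Squared norm in ℋ_λ. -/
noncomputable def normHlamSq (a lam : ℝ) (h u : V → ℝ) : ℝ :=
  ∑' x : V, (a * gradSq u x + hl lam h x * (u x) ^ 2)

/-- Squared H¹ norm. -/
noncomputable def normH1Sq (u : V → ℝ) : ℝ :=
  ∑' x : V, (gradSq u x + (u x) ^ 2)

/-- Inner product in ℋ_λ. -/
noncomputable def innerHlam (a lam : ℝ) (h u v : V → ℝ) : ℝ :=
  ∑' x : V, (a * gradForm u v x + hl lam h x * u x * v x)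

/-- The energy functional J_λ. -/
noncomputable def Jlam (a b p lam : ℝ) (h u : V → ℝ) : ℝ :=
  (1/2) * normHlamSq a lam h u
  + (b/4) * (∑' x : V, gradSq u x) ^ 2
  + (2/p^2) * ∑' x : V, |u x| ^ p
  - (1/p) * ∑' x : V, logTerm p (u x)

/-- The pairing (J′_λ(u), φ). -/
noncomputable def Jp (a b p lam : ℝ) (h u φ : V → ℝ) : ℝ :=
  (∑' x : V, (a * gradForm u φ x + hl lam h x * u x * φ x))
  + b * (∑' x : V, gradSq u x) * (∑' x : V, gradForm u φ x)
  - ∑' x : V, nlTerm p (u x) * φ x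

/-- The Nehari manifold N_λ. -/
def NSet (a b p lam : ℝ) (h : V → ℝ) : Set (V → ℝ) :=
  {u | memH h u ∧ u ≠ 0 ∧ Jp a b p lam h u u = 0}

/-- The sign-changing Nehari set M_λ. -/
def MSet (a b p lam : ℝ) (h : V → ℝ) : Set (V → ℝ) :=
  {u | memH h u ∧ pos u ≠ 0 ∧ neg u ≠ 0 ∧
       Jp a b p lam h u (pos u) = 0 ∧ Jp a b p lam h u (neg u) = 0}

/-- c_λ = inf_{N_λ} J_λ. -/
noncomputable def cLam (a b p lam : ℝ) (h : V → ℝ) : ℝ :=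
  sInf (Jlam a b p lam h '' NSet a b p lam h)

/-- m_λ = inf_{M_λ} J_λ. -/
noncomputable def mLam (a b p lam : ℝ) (h : V → ℝ) : ℝ :=
  sInf (Jlam a b p lam h '' MSet a b p lam h)

/-- Graph-connectedness of a subset of ℤ³. -/
def connectedIn (S : Set V) : Prop :=
  ∀ x ∈ S, ∀ y ∈ S, Relation.ReflTransGen (fun z w => adj z w ∧ w ∈ S) x y

/-- Hypothesis (h₁): h ≥ 0 and Ω = {h = 0} is nonempty, connected and finite. -/
def hypH1 (h : V → ℝ) : Prop :=
  (∀ x, 0 ≤ h x) ∧ {x | h x = 0}.Nonempty ∧ connectedIn {x | h x = 0} ∧ {x | h x = 0}.Finite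

/-- Hypothesis (h₂): the sublevel set {h < M} is finite for some M > 0. -/
def hypH2 (h : V → ℝ) : Prop :=
  ∃ M > 0, {x | h x < M}.Finite

/-- u solves the discrete logarithmic Kirchhoff equation pointwise on ℤ³. -/
def solvesEq (a b p lam : ℝ) (h u : V → ℝ) : Prop :=
  ∀ x : V, -(a + b * ∑' y : V, gradSq u y) * lap u x + hl lam h x * u x = nlTerm p (u x)

/-- Vertex boundary of a subset of ℤ³. -/
def bdry (S : Set V) : Set V := {y | y ∉ S ∧ ∃ x ∈ S, adj x y}

/-- ℋ¹₀(Ω): functions vanishing outside Ω. -/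
def H10 (S : Set V) : Set (V → ℝ) := {u | ∀ x, x ∉ S → u x = 0}

/-- The energy functional J_Ω. -/
noncomputable def JOm (a b p : ℝ) (S : Set V) (u : V → ℝ) : ℝ :=
  (1/2) * ∑' x : V, (S ∪ bdry S).indicator (fun x => a * gradSq u x) x
  + (1/2) * ∑' x : V, S.indicator (fun x => (u x) ^ 2) x
  + (b/4) * (∑' x : V, (S ∪ bdry S).indicator (gradSq u) x) ^ 2
  + (2/p^2) * ∑' x : V, S.indicator (fun x => |u x| ^ p) x
  - (1/p) * ∑' x : V, S.indicator (fun x => logTerm p (u x)) x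

/-- The pairing (J′_Ω(u), φ). -/
noncomputable def JOmp (a b p : ℝ) (S : Set V) (u φ : V → ℝ) : ℝ :=
  (∑' x : V, (S ∪ bdry S).indicator (fun x => a * gradForm u φ x) x)
  + (∑' x : V, S.indicator (fun x => u x * φ x) x)
  + b * (∑' x : V, (S ∪ bdry S).indicator (gradSq u) x)
      * (∑' x : V, (S ∪ bdry S).indicator (gradForm u φ) x)
  - ∑' x : V, S.indicator (fun x => nlTerm p (u x) * φ x) x

/-- The Nehari manifold N_Ω. -/
def NOm (a b p : ℝ) (S : Set V) : Set (V → ℝ) :=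
  {u | u ∈ H10 S ∧ u ≠ 0 ∧ JOmp a b p S u u = 0}

/-- The sign-changing Nehari set M_Ω. -/
def MOm (a b p : ℝ) (S : Set V) : Set (V → ℝ) :=
  {u | u ∈ H10 S ∧ pos u ≠ 0 ∧ neg u ≠ 0 ∧
       JOmp a b p S u (pos u) = 0 ∧ JOmp a b p S u (neg u) = 0}

/-- c_Ω. -/
noncomputable def cOm (a b p : ℝ) (S : Set V) : ℝ :=
  sInf (JOm a b p S '' NOm a b p S)

/-- m_Ω. -/
noncomputable def mOm (a b p : ℝ) (S : Set V) : ℝ :=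
  sInf (JOm a b p S '' MOm a b p S)

/-- u solves the limiting equation pointwise on Ω. -/
def solvesEqOm (a b p : ℝ) (S : Set V) (u : V → ℝ) : Prop :=
  ∀ x ∈ S, -(a + b * ∑' y : V, (S ∪ bdry S).indicator (gradSq u) y) * lap u x + u x
      = nlTerm p (u x)

/-- Coefficients of the energy on the two-dimensional cone spanned by two functions with disjoint
supports: `A, D, B` are the values of the inner product, `E₁, C, E₂` those of the Dirichlet form,
`P₁, P₂` the `p`-th power sums and `L₁, L₂` the logarithmic sums. -/
structure FiberCoeff where
  (A D B E₁ C E₂ P₁ L₁ P₂ L₂ : ℝ)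

/-- The energy `J(s v + t w)` in terms of the coefficients. -/
noncomputable def FiberCoeff.energy (k : FiberCoeff) (b p s t : ℝ) : ℝ :=
  1 / 2 * (s ^ 2 * k.A + 2 * s * t * k.D + t ^ 2 * k.B)
  + b / 4 * (s ^ 2 * k.E₁ + 2 * s * t * k.C + t ^ 2 * k.E₂) ^ 2
  + 2 / p ^ 2 * (s ^ p * k.P₁ + t ^ p * k.P₂)
  - 1 / p * (s ^ p * k.L₁ + s ^ p * Real.log (s ^ 2) * k.P₁
      + (t ^ p * k.L₂ + t ^ p * Real.log (t ^ 2) * k.P₂))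

/-- The pairing `(J′(s v + t w), s v)` in terms of the coefficients. -/
noncomputable def FiberCoeff.slope (k : FiberCoeff) (b p s t : ℝ) : ℝ :=
  s ^ 2 * k.A + s * t * k.D
  + b * (s ^ 2 * k.E₁ + 2 * s * t * k.C + t ^ 2 * k.E₂) * (s ^ 2 * k.E₁ + s * t * k.C)
  - (s ^ p * k.L₁ + s ^ p * Real.log (s ^ 2) * k.P₁)

/-- The coefficients with the roles of the two functions exchanged. -/
def FiberCoeff.swap (k : FiberCoeff) : FiberCoeff :=
  ⟨k.B, k.D, k.A, k.E₂, k.C, k.E₁, k.P₂, k.L₂, k.P₁, k.L₁⟩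

theorem FiberCoeff.energy_swap (k : FiberCoeff) (b p s t : ℝ) :
    k.swap.energy b p t s = k.energy b p s t := by
  simp only [energy, swap]; ring

theorem rpow_bernoulli_gap {p q s : ℝ} (hq : 0 < q) (hqp : q ≤ p) (hs : 0 < s) :
    0 ≤ (1 - s ^ q) / q - (1 - s ^ p) / p := by
  have h1 := one_add_mul_self_le_rpow_one_add (s := s ^ q - 1)
    (by linarith [Real.rpow_nonneg hs.le q]) (p := p / q) ((one_le_div hq).2 hqp)
  rw [add_sub_cancel, ← Real.rpow_mul hs.le, mul_div_cancel₀ _ hq.ne'] at h1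
  have hp : 0 < p := hq.trans_le hqp
  have : (1 - s ^ q) / q - (1 - s ^ p) / p = (s ^ p - (1 + p / q * (s ^ q - 1))) / p := by
    field_simp; ring
  rw [this]; exact div_nonneg (by linarith) hp.le

theorem rpow_bernoulli_gap_pos {p q s : ℝ} (hq : 0 < q) (hqp : q < p) (hs : 0 < s)
    (hs1 : s ≠ 1) : 0 < (1 - s ^ q) / q - (1 - s ^ p) / p := by
  have hne : s ^ q - 1 ≠ 0 := by
    intro h0
    apply hs1
    have : s ^ q = 1 ^ q := by rw [Real.one_rpow]; linarith
    exact (Real.rpow_left_inj hs.le zero_le_one hq.ne').1 this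
  have h1 := one_add_mul_self_lt_rpow_one_add (s := s ^ q - 1)
    (by linarith [Real.rpow_nonneg hs.le q]) hne (p := p / q) ((one_lt_div hq).2 hqp)
  rw [add_sub_cancel, ← Real.rpow_mul hs.le, mul_div_cancel₀ _ hq.ne'] at h1
  have hp : 0 < p := hq.trans hqp
  have : (1 - s ^ q) / q - (1 - s ^ p) / p = (s ^ p - (1 + p / q * (s ^ q - 1))) / p := by
    field_simp; ring
  rw [this]; exact div_pos (by linarith) hp

theorem rpow_log_gap {p s : ℝ} (hp : 0 < p) (hs : 0 < s) :
    0 ≤ 2 / p ^ 2 * (1 - s ^ p) + 1 / p * (s ^ p * Real.log (s ^ 2)) := by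
  have h1 := Real.one_sub_inv_le_log_of_pos (Real.rpow_pos_of_pos hs p)
  rw [Real.log_rpow hs] at h1
  have h2 := mul_le_mul_of_nonneg_left h1 (Real.rpow_nonneg hs.le p)
  rw [mul_sub, mul_inv_cancel₀ (Real.rpow_pos_of_pos hs p).ne'] at h2
  have : 2 / p ^ 2 * (1 - s ^ p) + 1 / p * (s ^ p * Real.log (s ^ 2))
      = 2 / p ^ 2 * (1 - s ^ p + s ^ p * (p * Real.log s)) := by
    rw [Real.log_pow]; field_simp; push_cast; ring
  rw [this]; exact mul_nonneg (by positivity) (by linarith)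

/-- If both slopes vanish at `(1, 1)`, then `(1, 1)` maximises the energy, with a quantitative
gap. -/
theorem FiberCoeff.energy_add_gap_le (k : FiberCoeff) {b p s t : ℝ} (hb : 0 < b) (hp : 4 < p)
    (hD : 0 ≤ k.D) (hE₁ : 0 ≤ k.E₁) (hC : 0 ≤ k.C)
    (hE₂ : 0 ≤ k.E₂) (hP₁ : 0 ≤ k.P₁) (hP₂ : 0 ≤ k.P₂) (h1 : k.slope b p 1 1 = 0)
    (h2 : k.swap.slope b p 1 1 = 0) (hs : 0 < s) (ht : 0 < t) :
    k.energy b p s t + k.A * ((1 - s ^ 2) / 2 - (1 - s ^ p) / p)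
      + k.B * ((1 - t ^ 2) / 2 - (1 - t ^ p) / p) ≤ k.energy b p 1 1 := by
  have hp0 : 0 < p := by linarith
  simp only [slope, swap, Real.one_rpow, one_pow, Real.log_one] at h1 h2
  have s2 := rpow_bernoulli_gap (q := 2) two_pos (by linarith : (2:ℝ) ≤ p) hs
  have t2 := rpow_bernoulli_gap (q := 2) two_pos (by linarith : (2:ℝ) ≤ p) ht
  have s4 := rpow_bernoulli_gap (q := 4) four_pos hp.le hs
  have t4 := rpow_bernoulli_gap (q := 4) four_pos hp.le ht
  have sl := rpow_log_gap hp0 hs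
  have tl := rpow_log_gap hp0 ht
  rw [show (2:ℝ) = ((2:ℕ):ℝ) by norm_num, Real.rpow_natCast] at s2 t2
  rw [show (4:ℝ) = ((4:ℕ):ℝ) by norm_num, Real.rpow_natCast] at s4 t4
  push_cast at s2 t2 s4 t4
  have hL1 : k.L₁ = k.A + k.D + b * (k.E₁ + 2 * k.C + k.E₂) * (k.E₁ + k.C) := by linarith
  have hL2 : k.L₂ = k.B + k.D + b * (k.E₁ + 2 * k.C + k.E₂) * (k.E₂ + k.C) := by linarith
  set X := k.E₁ + k.C with hX
  set Y := k.E₂ + k.C with hY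
  have hX0 : 0 ≤ X := by positivity
  have hY0 : 0 ≤ Y := by positivity
  have hXY : k.E₁ + 2 * k.C + k.E₂ = X + Y := by rw [hX, hY]; ring
  have hm : s ^ 2 * k.E₁ + 2 * s * t * k.C + t ^ 2 * k.E₂ ≤ s ^ 2 * X + t ^ 2 * Y := by
    nlinarith [mul_nonneg hC (sq_nonneg (s - t))]
  have hm0 : 0 ≤ s ^ 2 * k.E₁ + 2 * s * t * k.C + t ^ 2 * k.E₂ := by positivity
  have hsq : (s ^ 2 * k.E₁ + 2 * s * t * k.C + t ^ 2 * k.E₂) ^ 2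
      ≤ (X + Y) * (s ^ 4 * X + t ^ 4 * Y) := by
    calc _ ≤ (s ^ 2 * X + t ^ 2 * Y) ^ 2 := pow_le_pow_left₀ hm0 hm 2
      _ ≤ _ := by nlinarith [mul_nonneg (mul_nonneg hX0 hY0) (sq_nonneg (s ^ 2 - t ^ 2))]
  have hst : s * t ≤ (s ^ 2 + t ^ 2) / 2 := by nlinarith [sq_nonneg (s - t)]
  have e1 := mul_nonneg hP₁ sl
  have e2 := mul_nonneg hP₂ tl
  have e3 : 0 ≤ k.D * ((1 - s * t) - (1 - s ^ p) / p - (1 - t ^ p) / p) :=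
    mul_nonneg hD (by linarith)
  have e4 := mul_nonneg (mul_nonneg hb.le (add_nonneg hX0 hY0)) (mul_nonneg hX0 s4)
  have e5 := mul_nonneg (mul_nonneg hb.le (add_nonneg hX0 hY0)) (mul_nonneg hY0 t4)
  have e6 := mul_le_mul_of_nonneg_left hsq (by positivity : 0 ≤ b / 4)
  simp only [energy, Real.one_rpow, one_pow, Real.log_one, hL1, hL2, hXY]
  simp only [mul_one, one_mul, mul_zero, zero_mul, add_zero, hXY]
  clear_value X Y
  clear hX hY hL1 hL2 h1 h2 sl tl s2 t2 s4 t4 hst hm hm0 hsq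
  generalize (s ^ 2 * k.E₁ + 2 * s * t * k.C + t ^ 2 * k.E₂) ^ 2 = W at *
  simp only [div_eq_mul_inv, one_mul] at *
  linarith

theorem hasDerivAt_rpow_mul_log {p s : ℝ} (hs : 0 < s) :
    HasDerivAt (fun x : ℝ => x ^ p * Real.log (x ^ 2))
      (p * s ^ (p - 1) * Real.log (s ^ 2) + 2 * s ^ (p - 1)) s := by
  have h1 := Real.hasDerivAt_rpow_const (p := p) (Or.inl hs.ne')
  have h2 := ((hasDerivAt_pow 2 s).log (pow_pos hs 2).ne')
  refine (h1.mul h2).congr_deriv ?_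
  rw [Real.rpow_sub_one hs.ne']; field_simp; norm_num; ring

theorem FiberCoeff.hasDerivAt_energy (k : FiberCoeff) {b p s : ℝ} (t : ℝ) (hp : 0 < p)
    (hs : 0 < s) : HasDerivAt (fun x => k.energy b p x t) (k.slope b p s t / s) s := by
  have h1 := Real.hasDerivAt_rpow_const (p := p) (Or.inl hs.ne')
  have h2 := hasDerivAt_rpow_mul_log (p := p) hs
  have i := hasDerivAt_id s
  have q : ∀ A D B : ℝ, HasDerivAt (fun x : ℝ => x ^ 2 * A + 2 * x * t * D + t ^ 2 * B)
      (2 * s * A + 2 * t * D) s := by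
    intro A D B
    refine ((((hasDerivAt_pow 2 s).mul_const A).add
      (((i.const_mul 2).mul_const t).mul_const D)).add_const (t ^ 2 * B)).congr_deriv ?_
    norm_num
  have := (((q k.A k.D k.B).const_mul (1 / 2)).add
    (((q k.E₁ k.C k.E₂).pow 2).const_mul (b / 4))).add
    (((h1.mul_const k.P₁).add_const (t ^ p * k.P₂)).const_mul (2 / p ^ 2)) |>.sub
    ((((h1.mul_const k.L₁).add (h2.mul_const k.P₁)).add_const
      (t ^ p * k.L₂ + t ^ p * Real.log (t ^ 2) * k.P₂)).const_mul (1 / p))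
  refine HasDerivAt.congr_deriv this ?_
  simp only [slope]
  rw [Real.rpow_sub_one hs.ne']; field_simp; push_cast; ring

theorem FiberCoeff.slope_eq_zero_of_isLocalMax (k : FiberCoeff) {b p s t : ℝ} (hp : 0 < p)
    (hs : 0 < s) (ht : 0 < t)
    (hm : IsLocalMax (fun q : ℝ × ℝ => k.energy b p q.1 q.2) (s, t)) :
    k.slope b p s t = 0 ∧ k.swap.slope b p t s = 0 := by
  have c1 : Tendsto (fun x : ℝ => (x, t)) (nhds s) (nhds (s, t)) :=
    (Continuous.prodMk_left t).tendsto s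
  have c2 : Tendsto (fun x : ℝ => (s, x)) (nhds t) (nhds (s, t)) :=
    (Continuous.prodMk_right s).tendsto t
  have m1 : IsLocalMax (fun x => k.energy b p x t) s := c1.eventually hm
  have m2 : IsLocalMax (fun x => k.swap.energy b p x s) t := by
    simp only [energy_swap]; exact c2.eventually hm
  have d1 := m1.hasDerivAt_eq_zero (k.hasDerivAt_energy t hp hs)
  have d2 := m2.hasDerivAt_eq_zero (k.swap.hasDerivAt_energy s hp ht)
  rw [div_eq_zero_iff] at d1 d2
  exact ⟨d1.resolve_right hs.ne', d2.resolve_right ht.ne'⟩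

theorem continuous_rpow_mul_log {p : ℝ} (hp : 1 ≤ p) :
    Continuous fun x : ℝ => |x| ^ p * Real.log (x ^ 2) := by
  have h : (fun x : ℝ => |x| ^ p * Real.log (x ^ 2))
      = fun x => 2 * (|x| ^ (p - 1) * (|x| * Real.log |x|)) := by
    ext x
    rcases eq_or_ne x 0 with rfl | hx
    · simp [Real.zero_rpow (by linarith : p ≠ 0)]
    · rw [← sq_abs, Real.log_pow, Real.rpow_sub_one (abs_pos.2 hx).ne']
      have := (abs_pos.2 hx).ne'
      field_simp; push_cast; ring
  rw [h]
  have h1 : Continuous fun x : ℝ => |x| ^ (p - 1) :=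
    continuous_abs.rpow_const fun _ => Or.inr (by linarith)
  have h2 : Continuous fun x : ℝ => |x| * Real.log |x| :=
    Real.continuous_mul_log.comp continuous_abs
  exact continuous_const.mul (h1.mul h2)

theorem tendsto_fiber_atBot {p c d α P : ℝ} (hp : 4 < p) (hP : 0 < P) :
    Tendsto (fun s : ℝ => c * s ^ 2 + d * s ^ 4 + α * s ^ p - s ^ p * Real.log (s ^ 2) * P)
      atTop atBot := by
  have h1 : Tendsto (fun s : ℝ => s ^ p) atTop atTop := tendsto_rpow_atTop (by linarith)
  have e2 : Tendsto (fun s : ℝ => s ^ (-(p - 2))) atTop (nhds 0) :=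
    tendsto_rpow_neg_atTop (by linarith)
  have e4 : Tendsto (fun s : ℝ => s ^ (-(p - 4))) atTop (nhds 0) :=
    tendsto_rpow_neg_atTop (by linarith)
  have hl : Tendsto (fun s : ℝ => -(Real.log (s ^ 2) * P)) atTop atBot := by
    refine tendsto_neg_atTop_atBot.comp (Tendsto.atTop_mul_const hP ?_)
    exact Real.tendsto_log_atTop.comp (tendsto_pow_atTop two_ne_zero)
  have hb : Tendsto (fun s : ℝ => (c * s ^ (-(p - 2)) + d * s ^ (-(p - 4)) + α)
      + -(Real.log (s ^ 2) * P)) atTop atBot :=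
    (((e2.const_mul c).add (e4.const_mul d)).add_const α).add_atBot hl
  refine (h1.atTop_mul_atBot₀ hb).congr' ?_
  filter_upwards [eventually_gt_atTop 0] with s hs
  have r2 : s ^ p * s ^ (-(p - 2)) = s ^ 2 := by
    rw [← Real.rpow_add hs, ← Real.rpow_natCast]; congr 1; push_cast; ring
  have r4 : s ^ p * s ^ (-(p - 4)) = s ^ 4 := by
    rw [← Real.rpow_add hs, ← Real.rpow_natCast]; congr 1; push_cast; ring
  rw [← r2, ← r4]; ring

theorem exists_pos_fiber_gt {p A α β : ℝ} (hp : 4 < p) (hA : 0 < A) :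
    ∀ R > 0, ∃ s, 0 < s ∧ s < R ∧ 0 < A * s ^ 2 + α * s ^ p - β * (s ^ p * Real.log (s ^ 2)) := by
  intro R hR
  have c1 : Continuous fun s : ℝ => A + α * |s| ^ (p - 2)
      - β * (|s| ^ (p - 2) * Real.log (s ^ 2)) :=
    (continuous_const.add (continuous_const.mul
      (continuous_abs.rpow_const fun _ => Or.inr (by linarith)))).sub
      (continuous_const.mul (continuous_rpow_mul_log (by linarith)))
  have h0 : ∀ᶠ s in nhds (0:ℝ), 0 < A + α * |s| ^ (p - 2)
      - β * (|s| ^ (p - 2) * Real.log (s ^ 2)) := by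
    refine c1.continuousAt.eventually (lt_mem_nhds ?_)
    simpa [Real.zero_rpow (by linarith : p - 2 ≠ 0)] using hA
  have h1 := (h0.filter_mono nhdsWithin_le_nhds).and
    (Ioo_mem_nhdsGT hR)
  obtain ⟨s, hs, hs0, hsR⟩ := h1.exists
  refine ⟨s, hs0, hsR, ?_⟩
  rw [abs_of_pos hs0] at hs
  have : s ^ p = s ^ 2 * s ^ (p - 2) := by
    rw [← Real.rpow_natCast, ← Real.rpow_add hs0]; congr 1; push_cast; ring
  rw [this]
  nlinarith [mul_pos (pow_pos hs0 2) hs]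

theorem continuousOn_rpow_mul_log {p : ℝ} (hp : 1 ≤ p) :
    ContinuousOn (fun x : ℝ => x ^ p * Real.log (x ^ 2)) (Set.Ici 0) :=
  (continuous_rpow_mul_log hp).continuousOn.congr fun x hx => by
    simp only [abs_of_nonneg (Set.mem_Ici.1 hx)]

theorem exists_fiber_bound {p : ℝ} (hp : 4 < p) (c d α : ℝ) {P : ℝ} (hP : 0 < P) :
    ∃ M, ∀ s, 0 ≤ s →
      c * s ^ 2 + d * s ^ 4 + α * s ^ p - s ^ p * Real.log (s ^ 2) * P ≤ M := by
  have hc : ContinuousOn (fun s : ℝ => c * s ^ 2 + d * s ^ 4 + α * s ^ p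
      - s ^ p * Real.log (s ^ 2) * P) (Set.Ici 0) := by
    have h1 : Continuous fun s : ℝ => s ^ p := Real.continuous_rpow_const (by linarith)
    exact ContinuousOn.sub (by fun_prop)
      ((continuousOn_rpow_mul_log (by linarith)).mul continuousOn_const)
  obtain ⟨R, hR⟩ := ((tendsto_fiber_atBot (c := c) (d := d) (α := α) hp hP).eventually
    (eventually_le_atBot 0)).exists_forall_of_atTop
  obtain ⟨M, hM⟩ := (isCompact_Icc (a := (0:ℝ)) (b := R)).bddAbove_image
    (hc.mono Set.Icc_subset_Ici_self)
  refine ⟨max M 0, fun s hs => ?_⟩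
  rcases le_total s R with h | h
  · exact (hM ⟨s, ⟨hs, h⟩, rfl⟩).trans (le_max_left _ _)
  · exact (hR s h).trans (le_max_right _ _)

theorem FiberCoeff.continuousOn_energy (k : FiberCoeff) {b p : ℝ} (hp : 1 ≤ p) :
    ContinuousOn (fun q : ℝ × ℝ => k.energy b p q.1 q.2) (Set.Ici 0 ×ˢ Set.Ici 0) := by
  have h0 : Continuous fun s : ℝ => s ^ p := Real.continuous_rpow_const (by linarith)
  have l1 : ContinuousOn (fun q : ℝ × ℝ => q.1 ^ p * Real.log (q.1 ^ 2))
      (Set.Ici 0 ×ˢ Set.Ici 0) :=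
    (continuousOn_rpow_mul_log hp).comp continuousOn_fst fun q hq => hq.1
  have l2 : ContinuousOn (fun q : ℝ × ℝ => q.2 ^ p * Real.log (q.2 ^ 2))
      (Set.Ici 0 ×ˢ Set.Ici 0) :=
    (continuousOn_rpow_mul_log hp).comp continuousOn_snd fun q hq => hq.2
  have r1 : Continuous fun q : ℝ × ℝ => q.1 ^ p := h0.comp continuous_fst
  have r2 : Continuous fun q : ℝ × ℝ => q.2 ^ p := h0.comp continuous_snd
  unfold energy
  refine ContinuousOn.sub (by fun_prop) (continuousOn_const.mul ?_)
  exact (((r1.mul_const _).continuousOn.add (l1.mul continuousOn_const))).add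
    ((r2.mul_const _).continuousOn.add (l2.mul continuousOn_const))

theorem FiberCoeff.exists_energy_gt_left (k : FiberCoeff) {b p t : ℝ} (hb : 0 < b) (hp : 4 < p)
    (hA : 0 < k.A) (hD : 0 ≤ k.D) (hE₁ : 0 ≤ k.E₁) (hC : 0 ≤ k.C) (hE₂ : 0 ≤ k.E₂)
    (ht : 0 ≤ t) {R : ℝ} (hR : 0 < R) :
    ∃ s, 0 < s ∧ s < R ∧ k.energy b p 0 t < k.energy b p s t := by
  obtain ⟨s, hs, hsR, h⟩ := exists_pos_fiber_gt (A := 1 / 2 * k.A)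
    (α := 2 / p ^ 2 * k.P₁ - 1 / p * k.L₁) (β := 1 / p * k.P₁) hp (by positivity) R hR
  refine ⟨s, hs, hsR, ?_⟩
  have h1 : 0 ≤ s * t * k.D := by positivity
  have h2 : (t ^ 2 * k.E₂) ^ 2 ≤ (s ^ 2 * k.E₁ + 2 * s * t * k.C + t ^ 2 * k.E₂) ^ 2 :=
    pow_le_pow_left₀ (by positivity) (le_add_of_nonneg_left (by positivity)) 2
  have h3 := mul_le_mul_of_nonneg_left h2 (by positivity : 0 ≤ b / 4)
  simp only [energy, Real.zero_rpow (by linarith : p ≠ 0)]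
  have e0 : (0:ℝ) ^ 2 * k.E₁ + 2 * 0 * t * k.C + t ^ 2 * k.E₂ = t ^ 2 * k.E₂ := by ring
  rw [e0]
  linarith

theorem FiberCoeff.exists_critical (k : FiberCoeff) {b p : ℝ} (hb : 0 < b) (hp : 4 < p)
    (hA : 0 < k.A) (hB : 0 < k.B) (hD : 0 ≤ k.D) (hE₁ : 0 ≤ k.E₁) (hC : 0 ≤ k.C)
    (hE₂ : 0 ≤ k.E₂) (hP₁ : 0 < k.P₁) (hP₂ : 0 < k.P₂) :
    ∃ s t, 0 < s ∧ 0 < t ∧ k.slope b p s t = 0 ∧ k.swap.slope b p t s = 0 := by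
  have hp0 : 0 < p := by linarith
  set g : ℝ → ℝ → ℝ → ℝ → ℝ → ℝ := fun a x P L s =>
    1 / 2 * a * s ^ 2 + b / 2 * x ^ 2 * s ^ 4 + (2 / p ^ 2 * P - 1 / p * L) * s ^ p
      - s ^ p * Real.log (s ^ 2) * (1 / p * P) with hg
  set g₁ := g (k.A + k.D) (k.E₁ + k.C) k.P₁ k.L₁ with hg₁
  set g₂ := g (k.B + k.D) (k.E₂ + k.C) k.P₂ k.L₂ with hg₂
  have hle : ∀ s t, 0 ≤ s → 0 ≤ t → k.energy b p s t ≤ g₁ s + g₂ t := by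
    intro s t hs ht
    have hst : 2 * s * t ≤ s ^ 2 + t ^ 2 := by nlinarith [sq_nonneg (s - t)]
    have h1 := mul_le_mul_of_nonneg_right hst hD
    have h2 := mul_le_mul_of_nonneg_right hst hC
    have h3 : (s ^ 2 * k.E₁ + 2 * s * t * k.C + t ^ 2 * k.E₂) ^ 2
        ≤ 2 * (s ^ 4 * (k.E₁ + k.C) ^ 2 + t ^ 4 * (k.E₂ + k.C) ^ 2) := by
      calc _ ≤ (s ^ 2 * (k.E₁ + k.C) + t ^ 2 * (k.E₂ + k.C)) ^ 2 :=
            pow_le_pow_left₀ (by positivity) (by linarith) 2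
        _ ≤ _ := by nlinarith [sq_nonneg (s ^ 2 * (k.E₁ + k.C) - t ^ 2 * (k.E₂ + k.C))]
    have h4 := mul_le_mul_of_nonneg_left h3 (by positivity : 0 ≤ b / 4)
    simp only [hg₁, hg₂, hg, energy]
    linarith
  have hPp : ∀ {P : ℝ}, 0 < P → 0 < 1 / p * P := fun h => by positivity
  obtain ⟨M₁, hM₁⟩ := exists_fiber_bound hp (1 / 2 * (k.A + k.D)) (b / 2 * (k.E₁ + k.C) ^ 2)
    (2 / p ^ 2 * k.P₁ - 1 / p * k.L₁) (hPp hP₁)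
  obtain ⟨M₂, hM₂⟩ := exists_fiber_bound hp (1 / 2 * (k.B + k.D)) (b / 2 * (k.E₂ + k.C) ^ 2)
    (2 / p ^ 2 * k.P₂ - 1 / p * k.L₂) (hPp hP₂)
  have t₁ : Tendsto g₁ atTop atBot := tendsto_fiber_atBot hp (hPp hP₁)
  have t₂ : Tendsto g₂ atTop atBot := tendsto_fiber_atBot hp (hPp hP₂)
  obtain ⟨R, hR₁, hR₂, hR⟩ := ((t₁.eventually (eventually_lt_atBot (-M₂))).and
    ((t₂.eventually (eventually_lt_atBot (-M₁))).and (eventually_gt_atTop 0))).exists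
  have h00 : k.energy b p 0 0 = 0 := by
    simp [energy, Real.zero_rpow hp0.ne']
  obtain ⟨⟨s, t⟩, ⟨⟨hs0, hsR⟩, ht0, htR⟩, hmax⟩ :=
    ((isCompact_Icc (a := (0:ℝ)) (b := R)).prod (isCompact_Icc (a := (0:ℝ)) (b := R))).exists_isMaxOn
      ⟨(0, 0), ⟨le_rfl, hR.le⟩, le_rfl, hR.le⟩
      ((k.continuousOn_energy (b := b) (by linarith : 1 ≤ p)).mono
        (Set.prod_mono Set.Icc_subset_Ici_self Set.Icc_subset_Ici_self))
  simp only at hs0 hsR ht0 htR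
  have hval : ∀ s' t', 0 ≤ s' → s' ≤ R → 0 ≤ t' → t' ≤ R →
      k.energy b p s' t' ≤ k.energy b p s t := fun s' t' a1 a2 a3 a4 =>
    hmax (show (s', t') ∈ _ from ⟨⟨a1, a2⟩, a3, a4⟩)
  have hnn : 0 ≤ k.energy b p s t := h00 ▸ hval 0 0 le_rfl hR.le le_rfl hR.le
  have hsR' : s < R := by
    refine lt_of_le_of_ne hsR fun h => ?_
    have h1 := hle s t hs0 ht0
    have h2 : g₂ t ≤ M₂ := hM₂ t ht0
    rw [h] at h1 hnn
    linarith
  have htR_lt : t < R := by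
    refine lt_of_le_of_ne htR fun h => ?_
    have h1 := hle s t hs0 ht0
    have h2 : g₁ s ≤ M₁ := hM₁ s hs0
    rw [h] at h1 hnn
    linarith
  have hs : 0 < s := by
    refine lt_of_le_of_ne hs0 fun h => ?_
    obtain ⟨s', h1, h2, h3⟩ := k.exists_energy_gt_left hb hp hA hD hE₁ hC hE₂ ht0 hR
    have := hval s' t h1.le h2.le ht0 htR
    rw [← h] at this
    linarith
  have ht : 0 < t := by
    refine lt_of_le_of_ne ht0 fun h => ?_
    obtain ⟨t', h1, h2, h3⟩ := k.swap.exists_energy_gt_left hb hp hB hD hE₂ hC hE₁ hs0 hR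
    simp only [energy_swap] at h3
    have := hval s t' hs0 hsR h1.le h2.le
    rw [← h] at this
    linarith
  refine ⟨s, t, hs, ht, k.slope_eq_zero_of_isLocalMax hp0 hs ht ?_⟩
  exact hmax.isLocalMax (prod_mem_nhds (Icc_mem_nhds hs hsR') (Icc_mem_nhds ht htR_lt))

/-- A strict maximum in `(s, t)` of a `C¹` family persists, with strictly smaller value, when the
parameter is moved in a direction of decrease. -/
theorem exists_perturbed_localMax {Γ : ℝ × ℝ × ℝ → ℝ}
    (hΓ : ∀ ε s t, 0 < s → 0 < t → ContDiffAt ℝ 1 Γ (ε, s, t)) {d : ℝ}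
    (hd : HasDerivAt (fun ε => Γ (ε, 1, 1)) d 0) (hd0 : d < 0)
    (hmax : ∀ s t, 0 < s → 0 < t → (s, t) ≠ (1, 1) → Γ (0, s, t) < Γ (0, 1, 1))
    {ρ : ℝ} (hρ : 0 < ρ) :
    ∃ ε s t, 0 < ε ∧ ε < ρ ∧ 0 < s ∧ 0 < t ∧
      IsLocalMax (fun q : ℝ × ℝ => Γ (ε, q)) (s, t) ∧ Γ (ε, s, t) < Γ (0, 1, 1) := by
  have hS := (hΓ 0 1 1 one_pos one_pos).hasStrictFDerivAt one_ne_zero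
  set F := fderiv ℝ Γ (0, 1, 1) with hF
  have hF1 : F (1, 0, 0) = d := by
    have h1 : HasDerivAt (fun ε : ℝ => ((ε, 1, 1) : ℝ × ℝ × ℝ)) (1, 0, 0) 0 :=
      (hasDerivAt_id 0).prodMk ((hasDerivAt_const 0 1).prodMk (hasDerivAt_const 0 1))
    have h2 := HasFDerivAt.comp_hasDerivAt (0:ℝ) (f := fun ε : ℝ => ((ε, 1, 1) : ℝ × ℝ × ℝ))
      hS.hasFDerivAt h1
    exact h2.unique hd
  have hlo := hS.isLittleO.def (c := -d / 2) (by linarith)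
  obtain ⟨η, hη, hball⟩ := Metric.eventually_nhds_iff.1 hlo
  set r := min (η / 2) (1 / 2) with hr
  have hr0 : 0 < r := lt_min (by linarith) (by norm_num)
  have hr1 : r ≤ η / 2 := min_le_left _ _
  have hr2 : r ≤ 1 / 2 := min_le_right _ _
  have hpos : ∀ q ∈ Metric.closedBall ((1, 1) : ℝ × ℝ) r, 0 < q.1 ∧ 0 < q.2 := by
    intro q hq
    rw [Metric.mem_closedBall, Prod.dist_eq, max_le_iff, Real.dist_eq, Real.dist_eq,
      abs_le, abs_le] at hq
    constructor <;> linarith [hq.1.1, hq.2.1]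
  have hcont : ∀ ε, ∀ q ∈ Metric.closedBall ((1, 1) : ℝ × ℝ) r, ContinuousAt Γ (ε, q) :=
    fun ε q hq => (hΓ ε q.1 q.2 (hpos q hq).1 (hpos q hq).2).continuousAt
  have hsph : ∀ᶠ ε in nhds (0:ℝ), ∀ q ∈ Metric.sphere ((1, 1) : ℝ × ℝ) r,
      Γ (ε, q) < Γ (ε, 1, 1) := by
    refine (isCompact_sphere _ _).eventually_forall_of_forall_eventually fun q hq => ?_
    have hq' := Metric.sphere_subset_closedBall hq
    have c1 : ContinuousAt (fun z : ℝ × ℝ × ℝ => Γ (z.1, 1, 1)) (0, q) := by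
      refine ContinuousAt.comp (f := fun z : ℝ × ℝ × ℝ => (z.1, (1:ℝ), (1:ℝ))) (g := Γ) ?_
        (by fun_prop)
      exact hcont 0 (1, 1) (Metric.mem_closedBall_self hr0.le)
    refine (hcont 0 q hq').eventually_lt c1 (hmax q.1 q.2 (hpos q hq').1 (hpos q hq').2 ?_)
    intro h
    have h' : q = (1, 1) := h
    rw [h', Metric.mem_sphere, dist_self] at hq
    exact hr0.ne hq
  have hsmall : ∀ᶠ ε in nhdsWithin (0:ℝ) (Set.Ioi 0), ε ∈ Set.Ioo 0 (min ρ r) :=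
    Ioo_mem_nhdsGT (lt_min hρ hr0)
  obtain ⟨ε, hε, hε0, hε1⟩ := ((hsph.filter_mono nhdsWithin_le_nhds).and hsmall).exists
  obtain ⟨q, hq, hqm⟩ := (isCompact_closedBall ((1, 1) : ℝ × ℝ) r).exists_isMaxOn
    ⟨(1, 1), Metric.mem_closedBall_self hr0.le⟩
    (f := fun q => Γ (ε, q)) (fun q hq => ((hcont ε q hq).comp
      (f := fun q : ℝ × ℝ => (ε, q)) (by fun_prop)).continuousWithinAt)
  have hqb : q ∈ Metric.ball ((1, 1) : ℝ × ℝ) r := by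
    rw [Metric.mem_ball]
    refine lt_of_le_of_ne hq fun h => ?_
    have h1 := hε q h
    have h2 : Γ (ε, 1, 1) ≤ Γ (ε, q) := hqm (Metric.mem_closedBall_self hr0.le)
    linarith
  refine ⟨ε, q.1, q.2, hε0, hε1.trans_le (min_le_left _ _), (hpos q hq).1, (hpos q hq).2,
    hqm.isLocalMax (Filter.mem_of_superset (Metric.isOpen_ball.mem_nhds hqb)
      Metric.ball_subset_closedBall), ?_⟩
  have hεr : ε < r := hε1.trans_le (min_le_right _ _)
  have hdist : dist (((ε, q), ((0:ℝ), q)) : (ℝ × ℝ × ℝ) × (ℝ × ℝ × ℝ)) ((0, 1, 1), (0, 1, 1)) < η := by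
    have hq3 := Metric.mem_closedBall.1 hq
    have : dist ε 0 < r := by rw [Real.dist_eq, sub_zero, abs_of_pos hε0]; exact hεr
    simp only [Prod.dist_eq (x := (ε, q)), Prod.dist_eq (x := ((0:ℝ), q)),
      Prod.dist_eq (x := ((ε, q), ((0:ℝ), q))), dist_self]
    refine max_lt (max_lt (by linarith) (by linarith)) (max_lt hη (by linarith))
  have key := hball hdist
  have hsub : ((ε, q) : ℝ × ℝ × ℝ) - (0, q) = ε • ((1, 0, 0) : ℝ × ℝ × ℝ) := by
    ext <;> simp
  simp only [hsub, map_smul, hF1, norm_smul, Real.norm_eq_abs, abs_of_pos hε0] at key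
  have hn : ‖((1, 0, 0) : ℝ × ℝ × ℝ)‖ = 1 := by simp [Prod.norm_def]
  rw [hn, smul_eq_mul] at key
  have h3 : Γ (ε, q) < Γ (0, q) := by
    have := (abs_le.1 key).2
    nlinarith
  have h4 : Γ (0, q) ≤ Γ (0, 1, 1) := by
    by_cases h : q = (1, 1)
    · rw [h]
    · exact (hmax q.1 q.2 (hpos q hq).1 (hpos q hq).2 h).le
  exact h3.trans_le h4

theorem adj_comm {x y : V} : adj x y ↔ adj y x := by
  unfold adj
  simp_rw [abs_sub_comm]

theorem not_adj_self (x : V) : ¬ adj x x := by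
  simp [adj]

theorem finite_adj (x : V) : {y | adj x y}.Finite := by
  refine (Set.finite_Icc (x - 1) (x + 1)).subset fun y hy => ?_
  have hy' : (∑ i, |x i - y i|) = 1 := hy
  have h : ∀ i, |x i - y i| ≤ 1 := fun i => hy' ▸
    Finset.single_le_sum (f := fun i => |x i - y i|) (fun i _ => abs_nonneg _) (Finset.mem_univ i)
  constructor <;> intro i <;> have := abs_le.1 (h i) <;> simp <;> omega

theorem summable_adj (x : V) (f : V → ℝ) : Summable fun y => if adj x y then f y else 0 := by
  refine summable_of_hasFiniteSupport ((finite_adj x).subset fun y hy => ?_)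
  by_contra h
  exact hy (if_neg h)

theorem gradForm_comm (u v : V → ℝ) (x : V) : gradForm u v x = gradForm v u x := by
  simp only [gradForm, mul_comm]

theorem gradForm_comb_left (s t : ℝ) (u v w : V → ℝ) (x : V) :
    gradForm (s • u + t • v) w x = s * gradForm u w x + t * gradForm v w x := by
  simp only [gradForm]
  rw [mul_left_comm s, mul_left_comm t, ← mul_add]
  congr 1
  rw [← tsum_mul_left (a := s), ← tsum_mul_left (a := t),
    ← ((summable_adj x _).mul_left s).tsum_add ((summable_adj x _).mul_left t)]
  congr 1
  ext y
  split_ifs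
  · simp only [Pi.add_apply, Pi.smul_apply, smul_eq_mul]; ring
  · simp

theorem gradForm_mono {u v u' v' : V → ℝ} {x : V}
    (h : ∀ y, adj x y → (u y - u x) * (v y - v x) ≤ (u' y - u' x) * (v' y - v' x)) :
    gradForm u v x ≤ gradForm u' v' x := by
  refine mul_le_mul_of_nonneg_left ?_ (by norm_num)
  refine (summable_adj x _).tsum_le_tsum (fun y => ?_) (summable_adj x _)
  split_ifs with hy
  · exact h y hy
  · exact le_rfl

theorem gradForm_nonneg {u v : V → ℝ} {x : V}
    (h : ∀ y, adj x y → 0 ≤ (u y - u x) * (v y - v x)) : 0 ≤ gradForm u v x := by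
  refine mul_nonneg (by norm_num) (tsum_nonneg fun y => ?_)
  split_ifs with hy
  · exact h y hy
  · exact le_rfl

theorem gradSq_nonneg (u : V → ℝ) (x : V) : 0 ≤ gradSq u x :=
  gradForm_nonneg fun _ _ => mul_self_nonneg _

theorem gradSq_comb (s t : ℝ) (u v : V → ℝ) (x : V) :
    gradSq (s • u + t • v) x
      = s ^ 2 * gradSq u x + 2 * s * t * gradForm u v x + t ^ 2 * gradSq v x := by
  simp only [gradSq]
  rw [gradForm_comb_left, gradForm_comm u, gradForm_comm v, gradForm_comb_left,
    gradForm_comb_left, gradForm_comm v u]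
  ring

theorem abs_gradForm_le (u v : V → ℝ) (x : V) : |gradForm u v x| ≤ gradSq u x + gradSq v x := by
  have h1 := gradSq_comb 1 1 u v x
  have h2 := gradSq_comb 1 (-1) u v x
  have h3 := gradSq_nonneg ((1:ℝ) • u + (1:ℝ) • v) x
  have h4 := gradSq_nonneg ((1:ℝ) • u + (-1:ℝ) • v) x
  have h5 := gradSq_nonneg u x
  have h6 := gradSq_nonneg v x
  rw [abs_le]
  constructor <;> linarith

theorem gradForm_single (u : V → ℝ) (x z : V) :
    gradForm u (Pi.single x 1) z
      = 1 / 2 * (if adj x z then u x - u z else 0) + if z = x then -(1 / 2) * lap u x else 0 := by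
  simp only [gradForm, lap]
  by_cases hz : z = x
  · subst hz
    rw [if_neg (not_adj_self z), if_pos rfl, mul_zero, zero_add, ← tsum_mul_left, ← tsum_mul_left]
    refine tsum_congr fun y => ?_
    split_ifs with hy
    · have : y ≠ z := fun e => not_adj_self z (e ▸ hy)
      simp only [Pi.single_eq_of_ne this, Pi.single_eq_same]; ring
    · simp
  · rw [if_neg hz, add_zero, tsum_eq_single x]
    · simp [Pi.single_eq_of_ne hz, adj_comm (x := z)]
    · intro y hy
      simp [Pi.single_eq_of_ne hz, Pi.single_eq_of_ne hy]

section Space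

variable {h : V → ℝ} {lam : ℝ}

theorem memH.summable_gradSq {u : V → ℝ} (hu : memH h u) : Summable (gradSq u) :=
  hu.1.of_nonneg_of_le (gradSq_nonneg u) fun _ => le_add_of_nonneg_right (sq_nonneg _)

theorem memH.summable_sq {u : V → ℝ} (hu : memH h u) : Summable fun x => u x ^ 2 :=
  hu.1.of_nonneg_of_le (fun _ => sq_nonneg _) fun x => le_add_of_nonneg_left (gradSq_nonneg u x)

theorem memH.summable_gradForm {u v : V → ℝ} (hu : memH h u) (hv : memH h v) :
    Summable (gradForm u v) :=
  Summable.of_norm_bounded (hu.summable_gradSq.add hv.summable_gradSq) (abs_gradForm_le u v)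

theorem memH.summable_mul {u v : V → ℝ} (hh : ∀ x, 0 ≤ h x) (hlam : 0 ≤ lam) (hu : memH h u)
    (hv : memH h v) : Summable fun x => hl lam h x * u x * v x := by
  refine Summable.of_norm_bounded (((hu.2.add hv.2).mul_left lam).add
    (hu.summable_sq.add hv.summable_sq)) fun x => ?_
  have h0 : 0 ≤ hl lam h x := by have := mul_nonneg hlam (hh x); simp only [hl]; linarith
  rw [Real.norm_eq_abs, mul_assoc, abs_mul, abs_of_nonneg h0]
  have h1 : |u x * v x| ≤ u x ^ 2 + v x ^ 2 := by
    rw [abs_le]; constructor <;> nlinarith [sq_nonneg (u x + v x), sq_nonneg (u x - v x)]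
  calc _ ≤ hl lam h x * (u x ^ 2 + v x ^ 2) := mul_le_mul_of_nonneg_left h1 h0
    _ = _ := by simp only [hl]; ring

theorem memH.comb {u v : V → ℝ} (hh : ∀ x, 0 ≤ h x) (hu : memH h u) (hv : memH h v) (s t : ℝ) :
    memH h (s • u + t • v) := by
  have h1 : Summable fun x => h x * (u x * v x) := by
    refine Summable.of_norm_bounded (hu.2.add hv.2) fun x => ?_
    rw [Real.norm_eq_abs, abs_mul, abs_of_nonneg (hh x), ← mul_add]
    refine mul_le_mul_of_nonneg_left ?_ (hh x)
    rw [abs_le]; constructor <;> nlinarith [sq_nonneg (u x + v x), sq_nonneg (u x - v x)]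
  have h2 : Summable fun x => u x * v x := by
    refine Summable.of_norm_bounded (hu.summable_sq.add hv.summable_sq) fun x => ?_
    rw [Real.norm_eq_abs, abs_le]
    constructor <;> nlinarith [sq_nonneg (u x + v x), sq_nonneg (u x - v x)]
  constructor
  · have := ((hu.summable_gradSq.mul_left (s ^ 2)).add
      ((hu.summable_gradForm hv).mul_left (2 * s * t))).add
      (hv.summable_gradSq.mul_left (t ^ 2)) |>.add
      (((hu.summable_sq.mul_left (s ^ 2)).add (h2.mul_left (2 * s * t))).add
      (hv.summable_sq.mul_left (t ^ 2)))
    refine this.congr fun x => ?_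
    rw [gradSq_comb]
    simp only [Pi.add_apply, Pi.smul_apply, smul_eq_mul]; ring
  · have := ((hu.2.mul_left (s ^ 2)).add (h1.mul_left (2 * s * t))).add (hv.2.mul_left (t ^ 2))
    refine this.congr fun x => ?_
    simp only [Pi.add_apply, Pi.smul_apply, smul_eq_mul]; ring

theorem memH.smul {u : V → ℝ} (hh : ∀ x, 0 ≤ h x) (hu : memH h u) (s : ℝ) : memH h (s • u) := by
  simpa using hu.comb hh hu s 0

theorem memH.pos {u : V → ℝ} (hh : ∀ x, 0 ≤ h x) (hu : memH h u) : memH h (pos u) := by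
  have hsq : ∀ x, DiscreteKirchhoff.pos u x ^ 2 ≤ u x ^ 2 := fun x => by
    simp only [DiscreteKirchhoff.pos]
    rcases le_total (u x) 0 with h | h <;> simp [h, sq_nonneg]
  refine ⟨hu.1.of_nonneg_of_le (fun x => add_nonneg (gradSq_nonneg _ x) (sq_nonneg _)) fun x =>
    add_le_add (gradForm_mono fun y _ => ?_) (hsq x),
    hu.2.of_nonneg_of_le (fun x => mul_nonneg (hh x) (sq_nonneg _))
      fun x => mul_le_mul_of_nonneg_left (hsq x) (hh x)⟩
  rw [← sq, ← sq]
  exact sq_le_sq.2 (abs_max_sub_max_le_abs _ _ _)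

theorem neg_eq (u : V → ℝ) : neg u = -pos (-u) := by
  ext x
  simp only [neg, pos, Pi.neg_apply]
  rw [← neg_zero, max_neg_neg, neg_neg, neg_zero]

theorem pos_neg (u : V → ℝ) : pos (-u) = -neg u := by rw [neg_eq, neg_neg]

theorem neg_neg' (u : V → ℝ) : neg (-u) = -pos u := by rw [neg_eq, neg_neg]

theorem memH.neg' {u : V → ℝ} (hh : ∀ x, 0 ≤ h x) (hu : memH h u) : memH h (-u) := by
  simpa using hu.smul hh (-1)

theorem memH.neg {u : V → ℝ} (hh : ∀ x, 0 ≤ h x) (hu : memH h u) : memH h (neg u) := by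
  rw [neg_eq]
  exact ((hu.neg' hh).pos hh).neg' hh

theorem memH_single (x : V) : memH h (Pi.single x 1) := by
  have hsup : ∀ f : V → ℝ, Summable fun z => f z * (Pi.single x 1 : V → ℝ) z ^ 2 := fun f =>
    summable_of_hasFiniteSupport ((Set.finite_singleton x).subset fun z hz => by
      by_contra hzx
      exact hz (by simp [Pi.single_eq_of_ne (show z ≠ x from hzx)]))
  refine ⟨Summable.add ?_ (by simpa using hsup 1), hsup h⟩
  refine summable_of_hasFiniteSupport (((finite_adj x).insert x).subset fun z hz => ?_)
  by_contra hzx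
  simp only [Set.mem_insert_iff, Set.mem_ofPred_eq, not_or] at hzx
  apply hz
  rw [gradSq, gradForm_single, if_neg hzx.1, if_neg hzx.2, mul_zero, add_zero]

/-- The bilinear Dirichlet form. -/
noncomputable def dirichlet (u v : V → ℝ) : ℝ := ∑' x, gradForm u v x

theorem dirichlet_comm (u v : V → ℝ) : dirichlet u v = dirichlet v u :=
  tsum_congr fun x => gradForm_comm u v x

theorem dirichlet_comb_left {u v w : V → ℝ} (hu : memH h u) (hv : memH h v) (hw : memH h w)
    (s t : ℝ) : dirichlet (s • u + t • v) w = s * dirichlet u w + t * dirichlet v w := by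
  simp only [dirichlet, gradForm_comb_left]
  rw [((hu.summable_gradForm hw).mul_left s).tsum_add ((hv.summable_gradForm hw).mul_left t),
    tsum_mul_left, tsum_mul_left]

theorem dirichlet_self_nonneg (u : V → ℝ) : 0 ≤ dirichlet u u := tsum_nonneg (gradSq_nonneg u)

theorem innerHlam_comm (a : ℝ) (u v : V → ℝ) : innerHlam a lam h u v = innerHlam a lam h v u :=
  tsum_congr fun x => by rw [gradForm_comm]; ring

theorem innerHlam_eq (a : ℝ) {u v : V → ℝ} (hh : ∀ x, 0 ≤ h x) (hlam : 0 ≤ lam) (hu : memH h u)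
    (hv : memH h v) :
    innerHlam a lam h u v = a * dirichlet u v + ∑' x, hl lam h x * u x * v x := by
  rw [innerHlam, ((hu.summable_gradForm hv).mul_left a).tsum_add (hu.summable_mul hh hlam hv),
    tsum_mul_left, dirichlet]

theorem innerHlam_comb_left (a : ℝ) {u v w : V → ℝ} (hh : ∀ x, 0 ≤ h x) (hlam : 0 ≤ lam)
    (hu : memH h u) (hv : memH h v) (hw : memH h w) (s t : ℝ) :
    innerHlam a lam h (s • u + t • v) w
      = s * innerHlam a lam h u w + t * innerHlam a lam h v w := by
  rw [innerHlam_eq a hh hlam (hu.comb hh hv s t) hw, innerHlam_eq a hh hlam hu hw,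
    innerHlam_eq a hh hlam hv hw, dirichlet_comb_left hu hv hw]
  have : ∑' x, hl lam h x * (s • u + t • v) x * w x
      = s * ∑' x, hl lam h x * u x * w x + t * ∑' x, hl lam h x * v x * w x := by
    rw [← tsum_mul_left, ← tsum_mul_left,
      ← ((hu.summable_mul hh hlam hw).mul_left s).tsum_add
        ((hv.summable_mul hh hlam hw).mul_left t)]
    refine tsum_congr fun x => ?_
    simp only [Pi.add_apply, Pi.smul_apply, smul_eq_mul]; ring
  rw [this]; ring

theorem summable_sq_le_innerHlam {a : ℝ} (ha : 0 ≤ a) {u : V → ℝ} (hh : ∀ x, 0 ≤ h x)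
    (hlam : 0 ≤ lam) (hu : memH h u) : ∑' x, u x ^ 2 ≤ innerHlam a lam h u u := by
  refine hu.summable_sq.tsum_le_tsum (fun x => ?_)
    (((hu.summable_gradForm hu).mul_left a).add (hu.summable_mul hh hlam hu))
  have h1 := mul_nonneg ha (gradSq_nonneg u x)
  have h2 := mul_nonneg (mul_nonneg hlam (hh x)) (sq_nonneg (u x))
  simp only [gradSq] at h1
  simp only [hl]
  nlinarith

theorem innerHlam_self_pos {a : ℝ} (ha : 0 ≤ a) {u : V → ℝ} (hh : ∀ x, 0 ≤ h x)
    (hlam : 0 ≤ lam) (hu : memH h u) (h0 : u ≠ 0) : 0 < innerHlam a lam h u u := by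
  obtain ⟨x, hx⟩ := Function.ne_iff.1 h0
  exact (hu.summable_sq.tsum_pos (fun _ => sq_nonneg _) x (by simpa using sq_pos_of_ne_zero hx)).trans_le
    (summable_sq_le_innerHlam ha hh hlam hu)

theorem gradForm_nonneg_of_disjoint {v w : V → ℝ} (hv : ∀ x, 0 ≤ v x) (hw : ∀ x, w x ≤ 0)
    (hvw : ∀ x, v x * w x = 0) (x : V) : 0 ≤ gradForm v w x :=
  gradForm_nonneg fun y _ => by
    nlinarith [hvw x, hvw y, mul_nonneg (hv x) (neg_nonneg.2 (hw y)),
      mul_nonneg (hv y) (neg_nonneg.2 (hw x))]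

theorem innerHlam_nonneg_of_disjoint {a : ℝ} (ha : 0 ≤ a) {v w : V → ℝ} (hv : ∀ x, 0 ≤ v x)
    (hw : ∀ x, w x ≤ 0) (hvw : ∀ x, v x * w x = 0) : 0 ≤ innerHlam a lam h v w :=
  tsum_nonneg fun x => by
    rw [mul_assoc, hvw x, mul_zero, add_zero]
    exact mul_nonneg ha (gradForm_nonneg_of_disjoint hv hw hvw x)

theorem dirichlet_single (u : V → ℝ) (x : V) : dirichlet u (Pi.single x 1) = -lap u x := by
  have h1 : Summable fun z => if z = x then -(1 / 2) * lap u x else 0 :=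
    (hasSum_ite_eq x _).summable
  simp only [dirichlet, gradForm_single]
  rw [((summable_adj x _).mul_left _).tsum_add h1, tsum_ite_eq, tsum_mul_left]
  have : ∑' z, (if adj x z then u x - u z else 0) = -lap u x := by
    rw [lap, ← tsum_neg]
    refine tsum_congr fun z => ?_
    split_ifs <;> simp
  rw [this]; ring

end Space

theorem logTerm_eq (p t : ℝ) : logTerm p t = |t| ^ p * Real.log (t ^ 2) := by
  rw [logTerm]; split_ifs with h <;> simp [h]

theorem nlTerm_eq (p t : ℝ) : nlTerm p t = |t| ^ (p - 2) * t * Real.log (t ^ 2) := by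
  rw [nlTerm]; split_ifs with h <;> simp [h]

theorem nlTerm_mul_self (p t : ℝ) : nlTerm p t * t = logTerm p t := by
  rw [logTerm_eq, nlTerm_eq]
  rcases eq_or_ne t 0 with rfl | ht
  · simp
  · have h := abs_pos.2 ht
    have : |t| ^ p = |t| ^ (p - 2) * t ^ 2 := by
      rw [← sq_abs, ← Real.rpow_natCast, ← Real.rpow_add h]; congr 1; push_cast; ring
    rw [this]; ring

theorem logTerm_mul {p s : ℝ} (hp : p ≠ 0) (hs : 0 < s) (r : ℝ) :
    logTerm p (s * r) = s ^ p * logTerm p r + s ^ p * Real.log (s ^ 2) * |r| ^ p := by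
  rw [logTerm_eq, logTerm_eq]
  rcases eq_or_ne r 0 with rfl | hr
  · simp [Real.zero_rpow hp]
  · rw [abs_mul, abs_of_pos hs, Real.mul_rpow hs.le (abs_nonneg r), mul_pow,
      Real.log_mul (by positivity) (by positivity)]
    ring

theorem summable_rpow {u : V → ℝ} (hu : Summable fun x => u x ^ 2) {p : ℝ} (hp : 2 ≤ p) :
    Summable fun x => |u x| ^ p := by
  have hev : ∀ᶠ x in cofinite, u x ^ 2 < 1 :=
    hu.tendsto_cofinite_zero.eventually (gt_mem_nhds one_pos)
  refine Summable.of_norm_bounded_eventually hu ?_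
  filter_upwards [hev] with x hx
  have h1 : |u x| ≤ 1 := by
    rw [← sq_abs] at hx
    exact (sq_lt_one_iff₀ (abs_nonneg _)).1 hx |>.le
  rw [Real.norm_eq_abs, abs_of_nonneg (by positivity), ← sq_abs]
  rcases (abs_nonneg (u x)).eq_or_lt with h0 | h0
  · rw [← h0, Real.zero_rpow (by linarith)]; norm_num
  · rw [← Real.rpow_natCast |u x| 2]
    exact Real.rpow_le_rpow_of_exponent_ge h0 h1 (by exact_mod_cast hp)

theorem abs_log_le_add_inv {r : ℝ} (hr : 0 < r) : |Real.log r| ≤ r + r⁻¹ := by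
  have h1 := Real.log_le_sub_one_of_pos hr
  have h2 := Real.one_sub_inv_le_log_of_pos hr
  have h3 := inv_pos.2 hr
  rw [abs_le]; constructor <;> linarith

theorem summable_logTerm {u : V → ℝ} (hu : Summable fun x => u x ^ 2) {p : ℝ} (hp : 3 ≤ p) :
    Summable fun x => logTerm p (u x) := by
  refine Summable.of_norm_bounded (((summable_rpow hu (p := p + 1) (by linarith)).add
    (summable_rpow hu (p := p - 1) (by linarith))).mul_left 2) fun x => ?_
  rw [logTerm_eq]
  rcases eq_or_ne (u x) 0 with h0 | h0
  · simp only [h0]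
    simp [Real.zero_rpow (by linarith : p ≠ 0)]
    positivity
  · have h := abs_pos.2 h0
    rw [← sq_abs, Real.log_pow, Real.rpow_add_one h.ne', Real.rpow_sub_one h.ne',
      Real.norm_eq_abs, abs_mul, abs_mul, abs_of_nonneg (by positivity : 0 ≤ |u x| ^ p)]
    have h1 := mul_le_mul_of_nonneg_left (abs_log_le_add_inv h)
      (by positivity : 0 ≤ 2 * |u x| ^ p)
    rw [Real.log_abs] at h1
    norm_num
    rw [div_eq_mul_inv]
    linarith

/-- The `p`-th power sum. -/
noncomputable def powSum (p : ℝ) (u : V → ℝ) : ℝ := ∑' x, |u x| ^ p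

/-- The logarithmic sum. -/
noncomputable def logSum (p : ℝ) (u : V → ℝ) : ℝ := ∑' x, logTerm p (u x)

theorem powSum_nonneg (p : ℝ) (u : V → ℝ) : 0 ≤ powSum p u :=
  tsum_nonneg fun _ => Real.rpow_nonneg (abs_nonneg _) _

section Space

variable {h : V → ℝ} {lam a b p : ℝ}

theorem powSum_pos {u : V → ℝ} (hu : memH h u) (hp : 2 ≤ p) (h0 : u ≠ 0) : 0 < powSum p u := by
  obtain ⟨x, hx⟩ := Function.ne_iff.1 h0
  exact (summable_rpow hu.summable_sq hp).tsum_pos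
    (fun _ => Real.rpow_nonneg (abs_nonneg _) _) x (Real.rpow_pos_of_pos (abs_pos.2 hx) _)

theorem Jlam_eq (u : V → ℝ) : Jlam a b p lam h u
    = 1 / 2 * innerHlam a lam h u u + b / 4 * dirichlet u u ^ 2 + 2 / p ^ 2 * powSum p u
      - 1 / p * logSum p u := by
  have : normHlamSq a lam h u = innerHlam a lam h u u :=
    tsum_congr fun x => by rw [gradSq]; ring
  rw [Jlam, this]; rfl

theorem Jp_eq (u φ : V → ℝ) : Jp a b p lam h u φ
    = innerHlam a lam h u φ + b * dirichlet u u * dirichlet u φ - ∑' x, nlTerm p (u x) * φ x :=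
  rfl

theorem Jp_self (u : V → ℝ) : Jp a b p lam h u u
    = innerHlam a lam h u u + b * dirichlet u u ^ 2 - logSum p u := by
  rw [Jp_eq, logSum]
  simp only [nlTerm_mul_self]
  ring

theorem dirichlet_comb_self {v w : V → ℝ} (hh : ∀ x, 0 ≤ h x) (hv : memH h v) (hw : memH h w)
    (s t : ℝ) : dirichlet (s • v + t • w) (s • v + t • w)
      = s ^ 2 * dirichlet v v + 2 * s * t * dirichlet v w + t ^ 2 * dirichlet w w := by
  rw [dirichlet_comb_left hv hw (hv.comb hh hw s t), dirichlet_comm v, dirichlet_comm w,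
    dirichlet_comb_left hv hw hv, dirichlet_comb_left hv hw hw, dirichlet_comm w v]
  ring

theorem innerHlam_comb_self {v w : V → ℝ} (hh : ∀ x, 0 ≤ h x) (hlam : 0 ≤ lam) (hv : memH h v)
    (hw : memH h w) (s t : ℝ) : innerHlam a lam h (s • v + t • w) (s • v + t • w)
      = s ^ 2 * innerHlam a lam h v v + 2 * s * t * innerHlam a lam h v w
        + t ^ 2 * innerHlam a lam h w w := by
  rw [innerHlam_comb_left a hh hlam hv hw (hv.comb hh hw s t), innerHlam_comm a v,
    innerHlam_comm a w, innerHlam_comb_left a hh hlam hv hw hv,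
    innerHlam_comb_left a hh hlam hv hw hw, innerHlam_comm a w v]
  ring

theorem powSum_smul (s : ℝ) (hs : 0 ≤ s) (v : V → ℝ) : powSum p (s • v) = s ^ p * powSum p v := by
  rw [powSum, powSum, ← tsum_mul_left]
  refine tsum_congr fun x => ?_
  rw [Pi.smul_apply, smul_eq_mul, abs_mul, abs_of_nonneg hs, Real.mul_rpow hs (abs_nonneg _)]

theorem logSum_smul (hp : 3 ≤ p) {s : ℝ} (hs : 0 < s) {v : V → ℝ} (hv : memH h v) :
    logSum p (s • v) = s ^ p * logSum p v + s ^ p * Real.log (s ^ 2) * powSum p v := by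
  rw [powSum, logSum, logSum, ← tsum_mul_left, ← tsum_mul_left,
    ← ((summable_logTerm hv.summable_sq hp).mul_left _).tsum_add
      ((summable_rpow hv.summable_sq (by linarith)).mul_left _)]
  refine tsum_congr fun x => ?_
  rw [Pi.smul_apply, smul_eq_mul, logTerm_mul (by linarith) hs]

theorem tsum_comp_add_of_disjoint {F : ℝ → ℝ} (h0 : F 0 = 0) {v w : V → ℝ}
    (hvw : ∀ x, v x * w x = 0) (hv : Summable fun x => F (v x)) (hw : Summable fun x => F (w x)) :
    ∑' x, F ((v + w) x) = ∑' x, F (v x) + ∑' x, F (w x) := by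
  rw [← hv.tsum_add hw]
  refine tsum_congr fun x => ?_
  rcases mul_eq_zero.1 (hvw x) with h | h <;> simp [h, h0]

/-- The fibering coefficients of a pair of functions. -/
noncomputable def fiberCoeff (a p lam : ℝ) (h v w : V → ℝ) : FiberCoeff where
  A := innerHlam a lam h v v
  D := innerHlam a lam h v w
  B := innerHlam a lam h w w
  E₁ := dirichlet v v
  C := dirichlet v w
  E₂ := dirichlet w w
  P₁ := powSum p v
  L₁ := logSum p v
  P₂ := powSum p w
  L₂ := logSum p w

theorem fiberCoeff_swap (v w : V → ℝ) :
    (fiberCoeff a p lam h v w).swap = fiberCoeff a p lam h w v := by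
  simp only [fiberCoeff, FiberCoeff.swap, innerHlam_comm a v w, dirichlet_comm v w]

theorem Jlam_comb (hp : 3 ≤ p) (hh : ∀ x, 0 ≤ h x) (hlam : 0 ≤ lam) {v w : V → ℝ}
    (hv : memH h v) (hw : memH h w) (hvw : ∀ x, v x * w x = 0) {s t : ℝ} (hs : 0 < s)
    (ht : 0 < t) :
    Jlam a b p lam h (s • v + t • w) = (fiberCoeff a p lam h v w).energy b p s t := by
  have hd : ∀ x, (s • v) x * (t • w) x = 0 := fun x => by
    simp only [Pi.smul_apply, smul_eq_mul]
    linear_combination s * t * hvw x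
  have hv' := (hv.smul hh s).summable_sq
  have hw' := (hw.smul hh t).summable_sq
  have h1 : powSum p (s • v + t • w) = s ^ p * powSum p v + t ^ p * powSum p w := by
    rw [← powSum_smul s hs.le, ← powSum_smul t ht.le]
    exact tsum_comp_add_of_disjoint (F := fun r => |r| ^ p)
      (by simp [Real.zero_rpow (by linarith : p ≠ 0)]) hd
      (summable_rpow hv' (by linarith)) (summable_rpow hw' (by linarith))
  have h2 : logSum p (s • v + t • w) = logSum p (s • v) + logSum p (t • w) :=
    tsum_comp_add_of_disjoint (F := logTerm p) (by simp [logTerm]) hd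
      (summable_logTerm hv' hp) (summable_logTerm hw' hp)
  rw [Jlam_eq, innerHlam_comb_self hh hlam hv hw, dirichlet_comb_self hh hv hw, h1, h2,
    logSum_smul hp hs hv, logSum_smul hp ht hw]
  rfl

theorem Jp_comb (hp : 3 ≤ p) (hh : ∀ x, 0 ≤ h x) (hlam : 0 ≤ lam) {v w : V → ℝ}
    (hv : memH h v) (hw : memH h w) (hvw : ∀ x, v x * w x = 0) {s : ℝ} (hs : 0 < s) (t : ℝ) :
    Jp a b p lam h (s • v + t • w) (s • v) = (fiberCoeff a p lam h v w).slope b p s t := by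
  have hc := hv.comb hh hw s t
  have e1 : innerHlam a lam h (s • v + t • w) (s • v)
      = s ^ 2 * innerHlam a lam h v v + s * t * innerHlam a lam h v w := by
    have := innerHlam_comb_left a hh hlam hv hw hc s 0
    rw [zero_smul, add_zero] at this
    rw [innerHlam_comm, this, innerHlam_comm a v, innerHlam_comb_left a hh hlam hv hw hv,
      innerHlam_comm a w v]
    ring
  have e2 : dirichlet (s • v + t • w) (s • v) = s ^ 2 * dirichlet v v + s * t * dirichlet v w := by
    have := dirichlet_comb_left hv hw hc s 0
    rw [zero_smul, add_zero] at this
    rw [dirichlet_comm, this, dirichlet_comm v, dirichlet_comb_left hv hw hv, dirichlet_comm w v]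
    ring
  have e3 : ∑' x, nlTerm p ((s • v + t • w) x) * (s • v) x = logSum p (s • v) := by
    refine tsum_congr fun x => ?_
    rw [← nlTerm_mul_self]
    rcases mul_eq_zero.1 (hvw x) with h | h <;> simp [h]
  rw [Jp_eq, e1, e2, e3, dirichlet_comb_self hh hv hw, logSum_smul hp hs hv]
  rfl

theorem pos_add_neg (u : V → ℝ) : pos u + neg u = u := by
  ext x; simp [pos, neg, max_add_min]

theorem pos_mul_neg (u : V → ℝ) (x : V) : pos u x * neg u x = 0 := by
  simp only [pos, neg]
  rcases le_total (u x) 0 with h | h <;> simp [h]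

theorem pos_nonneg (u : V → ℝ) (x : V) : 0 ≤ pos u x := le_max_right _ _

theorem neg_nonpos (u : V → ℝ) (x : V) : neg u x ≤ 0 := min_le_right _ _

theorem pos_add_of_disjoint {v w : V → ℝ} (hv : ∀ x, 0 ≤ v x) (hw : ∀ x, w x ≤ 0)
    (hvw : ∀ x, v x * w x = 0) : pos (v + w) = v := by
  ext x
  rcases mul_eq_zero.1 (hvw x) with h | h <;> simp [pos, h, hv x, hw x]

theorem neg_add_of_disjoint {v w : V → ℝ} (hv : ∀ x, 0 ≤ v x) (hw : ∀ x, w x ≤ 0)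
    (hvw : ∀ x, v x * w x = 0) : neg (v + w) = w := by
  ext x
  rcases mul_eq_zero.1 (hvw x) with h | h <;> simp [neg, h, hv x, hw x]

/-- A critical point of the fibering energy yields an element of `MSet`. -/
theorem comb_mem_MSet (hp : 3 ≤ p) (hh : ∀ x, 0 ≤ h x) (hlam : 0 ≤ lam) {v w : V → ℝ}
    (hv : memH h v) (hw : memH h w) (hv0 : ∀ x, 0 ≤ v x) (hw0 : ∀ x, w x ≤ 0)
    (hvw : ∀ x, v x * w x = 0) (hvne : v ≠ 0) (hwne : w ≠ 0) {s t : ℝ} (hs : 0 < s) (ht : 0 < t)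
    (h1 : (fiberCoeff a p lam h v w).slope b p s t = 0)
    (h2 : (fiberCoeff a p lam h v w).swap.slope b p t s = 0) :
    s • v + t • w ∈ MSet a b p lam h := by
  have hsv : ∀ x, 0 ≤ (s • v) x := fun x => mul_nonneg hs.le (hv0 x)
  have htw : ∀ x, (t • w) x ≤ 0 := fun x => mul_nonpos_of_nonneg_of_nonpos ht.le (hw0 x)
  have hd : ∀ x, (s • v) x * (t • w) x = 0 := fun x => by
    simp only [Pi.smul_apply, smul_eq_mul]
    linear_combination s * t * hvw x
  refine ⟨hv.comb hh hw s t, ?_, ?_, ?_, ?_⟩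
  · rw [pos_add_of_disjoint hsv htw hd]; exact smul_ne_zero hs.ne' hvne
  · rw [neg_add_of_disjoint hsv htw hd]; exact smul_ne_zero ht.ne' hwne
  · rw [pos_add_of_disjoint hsv htw hd, Jp_comb hp hh hlam hv hw hvw hs, h1]
  · rw [neg_add_of_disjoint hsv htw hd, add_comm,
      Jp_comb hp hh hlam hw hv (fun x => by rw [mul_comm, hvw x]) ht, ← fiberCoeff_swap, h2]

/-- The fibering slopes of `u⁺, u⁻` vanish at `(1, 1)` for `u ∈ MSet`. -/
theorem slope_eq_zero_of_mem_MSet (hp : 3 ≤ p) (hh : ∀ x, 0 ≤ h x) (hlam : 0 ≤ lam) {u : V → ℝ}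
    (hu : u ∈ MSet a b p lam h) :
    (fiberCoeff a p lam h (pos u) (neg u)).slope b p 1 1 = 0 ∧
      (fiberCoeff a p lam h (pos u) (neg u)).swap.slope b p 1 1 = 0 := by
  obtain ⟨hm, -, -, h1, h2⟩ := hu
  have hv := hm.pos hh
  have hw := hm.neg hh
  constructor
  · rw [← Jp_comb hp hh hlam hv hw (pos_mul_neg u) one_pos, one_smul, one_smul, pos_add_neg, h1]
  · rw [fiberCoeff_swap, ← Jp_comb hp hh hlam hw hv
      (fun x => by rw [mul_comm, pos_mul_neg u x]) one_pos, one_smul, one_smul,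
      add_comm, pos_add_neg, h2]

theorem Jlam_eq_energy (hp : 3 ≤ p) (hh : ∀ x, 0 ≤ h x) (hlam : 0 ≤ lam) {u : V → ℝ}
    (hu : memH h u) :
    Jlam a b p lam h u = (fiberCoeff a p lam h (pos u) (neg u)).energy b p 1 1 := by
  rw [← Jlam_comb hp hh hlam (hu.pos hh) (hu.neg hh) (pos_mul_neg u) one_pos one_pos,
    one_smul, one_smul, pos_add_neg]

theorem exists_mem_MSet (ha : 0 < a) (hb : 0 < b) (hp : 4 < p) (hh : ∀ x, 0 ≤ h x)
    (hlam : 0 ≤ lam) : (MSet a b p lam h).Nonempty := by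
  have h01 : (0 : V) ≠ 1 := zero_ne_one
  set v : V → ℝ := Pi.single 0 1 with hv
  set w : V → ℝ := -Pi.single 1 1 with hw
  have hvH : memH h v := memH_single 0
  have hwH : memH h w := (memH_single 1).neg' hh
  have hv0 : ∀ x, 0 ≤ v x := fun x => by
    rcases eq_or_ne x 0 with rfl | hx <;> simp [*]
  have hw0 : ∀ x, w x ≤ 0 := fun x => by
    rcases eq_or_ne x 1 with rfl | hx <;> simp [*]
  have hvw : ∀ x, v x * w x = 0 := fun x => by
    rcases eq_or_ne x 0 with rfl | hx <;> simp [*]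
  have hvne : v ≠ 0 := fun e => by simpa [hv] using congrFun e 0
  have hwne : w ≠ 0 := fun e => by simpa [hw] using congrFun e 1
  obtain ⟨s, t, hs, ht, h1, h2⟩ := (fiberCoeff a p lam h v w).exists_critical hb hp
    (innerHlam_self_pos ha.le hh hlam hvH hvne) (innerHlam_self_pos ha.le hh hlam hwH hwne)
    (innerHlam_nonneg_of_disjoint ha.le hv0 hw0 hvw) (dirichlet_self_nonneg v)
    (tsum_nonneg (gradForm_nonneg_of_disjoint hv0 hw0 hvw)) (dirichlet_self_nonneg w)
    (powSum_pos hvH (by linarith) hvne) (powSum_pos hwH (by linarith) hwne)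
  exact ⟨_, comb_mem_MSet (by linarith) hh hlam hvH hwH hv0 hw0 hvw hvne hwne hs ht h1 h2⟩

theorem exists_smul_mem_NSet (ha : 0 < a) (hb : 0 < b) (hp : 4 < p) (hh : ∀ x, 0 ≤ h x)
    (hlam : 0 ≤ lam) {v : V → ℝ} (hv : memH h v) (h0 : v ≠ 0) :
    ∃ s : ℝ, 0 < s ∧ s • v ∈ NSet a b p lam h := by
  set k : FiberCoeff := ⟨innerHlam a lam h v v, 0, 1, dirichlet v v, 0, 0, powSum p v,
    logSum p v, 1, 0⟩ with hk
  obtain ⟨s, t, hs, -, h1, -⟩ := k.exists_critical hb hp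
    (innerHlam_self_pos ha.le hh hlam hv h0) one_pos le_rfl (dirichlet_self_nonneg v) le_rfl
    le_rfl (powSum_pos hv (by linarith) h0) one_pos
  refine ⟨s, hs, hv.smul hh s, smul_ne_zero hs.ne' h0, ?_⟩
  have e1 := innerHlam_comb_self (a := a) hh hlam hv hv s 0
  have e2 := dirichlet_comb_self hh hv hv s 0
  rw [zero_smul, add_zero] at e1 e2
  rw [Jp_self, e1, e2, logSum_smul (by linarith) hs hv]
  simp only [FiberCoeff.slope, hk] at h1
  linear_combination h1

theorem Jp_eq_pos_add_neg (hp : 3 ≤ p) (hh : ∀ x, 0 ≤ h x) (hlam : 0 ≤ lam) {u : V → ℝ}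
    (hu : memH h u) : Jp a b p lam h u u = Jp a b p lam h u (pos u) + Jp a b p lam h u (neg u) := by
  have hv := hu.pos hh
  have hw := hu.neg hh
  have h1 := innerHlam_comb_left a hh hlam hv hw hu 1 1
  have h2 := dirichlet_comb_left hv hw hu 1 1
  have h3 : logSum p (pos u + neg u) = logSum p (pos u) + logSum p (neg u) :=
    tsum_comp_add_of_disjoint (F := logTerm p) (by simp [logTerm]) (pos_mul_neg u)
      (summable_logTerm hv.summable_sq hp) (summable_logTerm hw.summable_sq hp)
  have e1 : ∑' x, nlTerm p (u x) * pos u x = logSum p (pos u) := by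
    refine tsum_congr fun x => ?_
    rw [← nlTerm_mul_self]
    rcases le_total (u x) 0 with h | h <;> simp [pos, h]
  have e2 : ∑' x, nlTerm p (u x) * neg u x = logSum p (neg u) := by
    refine tsum_congr fun x => ?_
    rw [← nlTerm_mul_self]
    rcases le_total (u x) 0 with h | h <;> simp [neg, h]
  rw [one_smul, one_smul, pos_add_neg] at h1 h2
  rw [pos_add_neg] at h3
  rw [Jp_self, Jp_eq, Jp_eq, e1, e2, h3, h1, sq]
  rw [innerHlam_comm a (pos u), innerHlam_comm a (neg u)]
  nth_rewrite 2 [h2]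
  rw [dirichlet_comm (pos u), dirichlet_comm (neg u)]
  ring

theorem MSet_subset_NSet (hp : 3 ≤ p) (hh : ∀ x, 0 ≤ h x) (hlam : 0 ≤ lam) :
    MSet a b p lam h ⊆ NSet a b p lam h := by
  rintro u ⟨hu, h1, -, h3, h4⟩
  refine ⟨hu, fun e => h1 ?_, ?_⟩
  · ext x; simp [pos, e]
  · rw [Jp_eq_pos_add_neg hp hh hlam hu, h3, h4, add_zero]

/-- Coercivity of the energy on the Nehari set. -/
theorem innerHlam_le_of_mem_NSet (hb : 0 < b) (hp : 4 < p) {u : V → ℝ}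
    (hu : u ∈ NSet a b p lam h) :
    (1 / 2 - 1 / p) * innerHlam a lam h u u ≤ Jlam a b p lam h u := by
  have h1 := hu.2.2
  rw [Jp_self] at h1
  rw [Jlam_eq]
  have hL : logSum p u = innerHlam a lam h u u + b * dirichlet u u ^ 2 := by linarith
  rw [hL]
  have h2 : 0 ≤ (1 / 4 - 1 / p) * (b * dirichlet u u ^ 2) :=
    mul_nonneg (sub_nonneg.2 (one_div_le_one_div_of_le (by norm_num) hp.le)) (by positivity)
  have h3 : 0 ≤ 2 / p ^ 2 * powSum p u := mul_nonneg (by positivity) (powSum_nonneg p u)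
  linarith

theorem Jlam_nonneg_of_mem_NSet (ha : 0 < a) (hb : 0 < b) (hp : 4 < p) (hh : ∀ x, 0 ≤ h x)
    (hlam : 0 ≤ lam) {u : V → ℝ} (hu : u ∈ NSet a b p lam h) : 0 ≤ Jlam a b p lam h u :=
  (mul_nonneg (sub_nonneg.2 (one_div_le_one_div_of_le (by norm_num) (by linarith)))
    (innerHlam_self_pos ha.le hh hlam hu.1 hu.2.1).le).trans (innerHlam_le_of_mem_NSet hb hp hu)

theorem cLam_le (ha : 0 < a) (hb : 0 < b) (hp : 4 < p) (hh : ∀ x, 0 ≤ h x)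
    (hlam : 0 ≤ lam) {u : V → ℝ} (hu : u ∈ NSet a b p lam h) :
    cLam a b p lam h ≤ Jlam a b p lam h u :=
  csInf_le ⟨0, by rintro _ ⟨v, hv, rfl⟩; exact Jlam_nonneg_of_mem_NSet ha hb hp hh hlam hv⟩
    ⟨u, hu, rfl⟩

theorem mLam_le (ha : 0 < a) (hb : 0 < b) (hp : 4 < p) (hh : ∀ x, 0 ≤ h x)
    (hlam : 0 ≤ lam) {u : V → ℝ} (hu : u ∈ MSet a b p lam h) :
    mLam a b p lam h ≤ Jlam a b p lam h u :=
  csInf_le ⟨0, by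
    rintro _ ⟨v, hv, rfl⟩
    exact Jlam_nonneg_of_mem_NSet ha hb hp hh hlam
      (MSet_subset_NSet (by linarith) hh hlam hv)⟩ ⟨u, hu, rfl⟩

end Space

theorem half_sq_sub_le_gradSq (u : V → ℝ) {x y : V} (hxy : adj x y) :
    1 / 2 * (u y - u x) ^ 2 ≤ gradSq u x := by
  rw [gradSq, gradForm]
  refine mul_le_mul_of_nonneg_left ?_ (by norm_num)
  have := (summable_adj x fun y => (u y - u x) * (u y - u x)).le_tsum y fun z _ => by
    split_ifs
    · exact mul_self_nonneg _
    · exact le_rfl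
  rw [if_pos hxy] at this
  rw [sq]; exact this

/-- A one-dimensional interpolation inequality along a lattice line. -/
theorem sq_le_dirichlet_add {u : V → ℝ} (h1 : Summable fun x => u x ^ 2)
    (h2 : Summable (gradSq u)) (x : V) {θ : ℝ} (hθ : 0 < θ) :
    u x ^ 2 ≤ θ * dirichlet u u + 2 / θ * ∑' z, u z ^ 2 := by
  set l : ℕ → V := fun n => x + Pi.single 0 (n : ℤ) with hl
  have hinj : Function.Injective l := fun m n hmn => by
    have := congrFun hmn 0
    simpa [hl] using this
  have hadj : ∀ n, adj (l n) (l (n + 1)) := fun n => by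
    simp [adj, hl, Fin.sum_univ_three]
  have s1 : Summable fun n => u (l n) ^ 2 := h1.comp_injective hinj
  have s2 : Summable fun n => gradSq u (l n) := h2.comp_injective hinj
  have s3 : Summable fun n => u (l (n + 1)) ^ 2 :=
    s1.comp_injective (add_left_injective 1)
  have t1 : ∑' n, u (l n) ^ 2 ≤ ∑' z, u z ^ 2 :=
    tsum_comp_le_tsum_of_inj h1 (fun _ => sq_nonneg _) hinj
  have t2 : ∑' n, gradSq u (l n) ≤ dirichlet u u :=
    tsum_comp_le_tsum_of_inj h2 (gradSq_nonneg u) hinj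
  have t3 : ∑' n, u (l (n + 1)) ^ 2 ≤ ∑' n, u (l n) ^ 2 :=
    tsum_comp_le_tsum_of_inj s1 (fun _ => sq_nonneg _) (add_left_injective 1)
  have hstep : ∀ n, u (l n) ^ 2 - u (l (n + 1)) ^ 2
      ≤ θ * gradSq u (l n) + 1 / θ * (u (l n) ^ 2 + u (l (n + 1)) ^ 2) := fun n => by
    have h3 := half_sq_sub_le_gradSq u (hadj n)
    set p := u (l n)
    set q := u (l (n + 1))
    have h4 : p ^ 2 - q ^ 2 ≤ θ / 2 * (q - p) ^ 2 + 1 / (2 * θ) * (p + q) ^ 2 := by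
      have : θ / 2 * (q - p) ^ 2 + 1 / (2 * θ) * (p + q) ^ 2 - (p ^ 2 - q ^ 2)
          = (θ * (q - p) + (p + q)) ^ 2 / (2 * θ) := by field_simp; ring
      have h5 : 0 ≤ (θ * (q - p) + (p + q)) ^ 2 / (2 * θ) := by positivity
      linarith
    have h5 : 1 / (2 * θ) * (p + q) ^ 2 ≤ 1 / θ * (p ^ 2 + q ^ 2) := by
      have : 1 / θ * (p ^ 2 + q ^ 2) - 1 / (2 * θ) * (p + q) ^ 2
          = (p - q) ^ 2 / (2 * θ) := by field_simp; ring
      have h5 : 0 ≤ (p - q) ^ 2 / (2 * θ) := by positivity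
      linarith
    have h6 := mul_le_mul_of_nonneg_left h3 hθ.le
    linarith
  have sR := (s2.mul_left θ).add ((s1.add s3).mul_left (1 / θ))
  have hR : ∑' n, (θ * gradSq u (l n) + 1 / θ * (u (l n) ^ 2 + u (l (n + 1)) ^ 2))
      ≤ θ * dirichlet u u + 2 / θ * ∑' z, u z ^ 2 := by
    rw [(s2.mul_left θ).tsum_add ((s1.add s3).mul_left (1 / θ)), tsum_mul_left, tsum_mul_left,
      s1.tsum_add s3]
    have h3 := mul_le_mul_of_nonneg_left t2 hθ.le
    have h4 := mul_le_mul_of_nonneg_left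
      (by linarith : ∑' n, u (l n) ^ 2 + ∑' n, u (l (n + 1)) ^ 2 ≤ 2 * ∑' z, u z ^ 2)
      (by positivity : 0 ≤ 1 / θ)
    have h5 : 2 / θ * ∑' z, u z ^ 2 = 1 / θ * (2 * ∑' z, u z ^ 2) := by ring
    linarith
  have hN : ∀ N, u x ^ 2 - u (l N) ^ 2 ≤ θ * dirichlet u u + 2 / θ * ∑' z, u z ^ 2 := fun N => by
    have h3 := Finset.sum_range_sub' (fun n => u (l n) ^ 2) N
    have h0 : l 0 = x := by simp [hl]
    rw [h0] at h3
    rw [← h3]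
    exact ((Finset.sum_le_sum fun n _ => hstep n).trans
      (sR.sum_le_tsum _ fun n _ => add_nonneg (mul_nonneg hθ.le (gradSq_nonneg _ _))
        (by positivity))).trans hR
  have hlim := s1.tendsto_atTop_zero.const_sub (u x ^ 2)
  rw [sub_zero] at hlim
  exact le_of_tendsto hlim (Eventually.of_forall hN)

section Space

variable {h : V → ℝ} {lam a b p : ℝ}

theorem exists_one_lt_abs_of_mem_NSet (ha : 0 < a) (hb : 0 < b) (hh : ∀ x, 0 ≤ h x)
    (hlam : 0 ≤ lam) {v : V → ℝ} (hv : v ∈ NSet a b p lam h) : ∃ x, 1 < |v x| := by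
  by_contra! hle
  have h1 := hv.2.2
  rw [Jp_self] at h1
  have h2 : logSum p v ≤ 0 := tsum_nonpos fun x => by
    rw [logTerm_eq, ← sq_abs]
    exact mul_nonpos_of_nonneg_of_nonpos (by positivity)
      (Real.log_nonpos (by positivity) (pow_le_one₀ (abs_nonneg _) (hle x)))
  have h3 := innerHlam_self_pos ha.le hh hlam hv.1 hv.2.1
  have h4 : 0 ≤ b * dirichlet v v ^ 2 := by positivity
  linarith

theorem inv_le_dirichlet_of_mem_NSet (ha : 0 < a) (hb : 0 < b) (hp : 4 < p)
    (hh : ∀ x, 0 ≤ h x) (hlam : 0 ≤ lam) {v : V → ℝ} (hv : v ∈ NSet a b p lam h) {K : ℝ}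
    (hK : 0 < K) (hJ : Jlam a b p lam h v ≤ (1 / 2 - 1 / p) * K) :
    1 / (8 * K) ≤ dirichlet v v := by
  have hp' : 0 < 1 / 2 - 1 / p :=
    sub_pos.2 (one_div_lt_one_div_of_lt (by norm_num) (by linarith))
  have h1 : ∑' x, v x ^ 2 ≤ K := (summable_sq_le_innerHlam ha.le hh hlam hv.1).trans
    (le_of_mul_le_mul_left ((innerHlam_le_of_mem_NSet hb hp hv).trans hJ) hp')
  obtain ⟨x, hx⟩ := exists_one_lt_abs_of_mem_NSet ha hb hh hlam hv
  have h2 := sq_le_dirichlet_add hv.1.summable_sq hv.1.summable_gradSq x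
    (by positivity : 0 < 4 * K)
  have h3 : 1 < v x ^ 2 := by rw [← sq_abs]; exact one_lt_pow₀ hx two_ne_zero
  have h4 : 2 / (4 * K) * ∑' z, v z ^ 2 ≤ 1 / 2 := by
    refine (mul_le_mul_of_nonneg_left h1 (by positivity)).trans_eq ?_
    field_simp; norm_num
  rw [div_le_iff₀ (by positivity)]
  linarith

theorem Jlam_add_le (ha : 0 < a) (hb : 0 < b) (hp : 3 ≤ p) (hh : ∀ x, 0 ≤ h x)
    (hlam : 0 ≤ lam) {v w : V → ℝ} (hv : memH h v) (hw : memH h w) (hv0 : ∀ x, 0 ≤ v x)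
    (hw0 : ∀ x, w x ≤ 0) (hvw : ∀ x, v x * w x = 0) :
    Jlam a b p lam h v + Jlam a b p lam h w + b / 2 * (dirichlet v v * dirichlet w w)
      ≤ Jlam a b p lam h (v + w) := by
  have h1 : powSum p (v + w) = powSum p v + powSum p w :=
    tsum_comp_add_of_disjoint (F := fun r => |r| ^ p)
      (by simp [Real.zero_rpow (by linarith : p ≠ 0)]) hvw
      (summable_rpow hv.summable_sq (by linarith)) (summable_rpow hw.summable_sq (by linarith))
  have h2 : logSum p (v + w) = logSum p v + logSum p w :=
    tsum_comp_add_of_disjoint (F := logTerm p) (by simp [logTerm]) hvw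
      (summable_logTerm hv.summable_sq hp) (summable_logTerm hw.summable_sq hp)
  have h3 := innerHlam_comb_self (a := a) hh hlam hv hw 1 1
  have h4 := dirichlet_comb_self hh hv hw 1 1
  rw [one_smul, one_smul] at h3 h4
  rw [Jlam_eq, Jlam_eq, Jlam_eq, h1, h2, h3, h4]
  have h5 : 0 ≤ innerHlam a lam h v w := innerHlam_nonneg_of_disjoint ha.le hv0 hw0 hvw
  have h6 : 0 ≤ dirichlet v w := tsum_nonneg (gradForm_nonneg_of_disjoint hv0 hw0 hvw)
  have h7 := dirichlet_self_nonneg v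
  have h8 := dirichlet_self_nonneg w
  have h9 : 0 ≤ b / 4 * (4 * dirichlet v w * (dirichlet v v + dirichlet v w + dirichlet w w)) := by
    positivity
  linarith

theorem Jlam_comb_le_of_mem_MSet (ha : 0 < a) (hb : 0 < b) (hp : 4 < p) (hh : ∀ x, 0 ≤ h x)
    (hlam : 0 ≤ lam) {u : V → ℝ} (hu : u ∈ MSet a b p lam h) {s t : ℝ} (hs : 0 < s) (ht : 0 < t) :
    (fiberCoeff a p lam h (pos u) (neg u)).energy b p s t
      + innerHlam a lam h (pos u) (pos u) * ((1 - s ^ 2) / 2 - (1 - s ^ p) / p)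
      + innerHlam a lam h (neg u) (neg u) * ((1 - t ^ 2) / 2 - (1 - t ^ p) / p)
      ≤ Jlam a b p lam h u := by
  have hp' : 3 ≤ p := by linarith
  obtain ⟨e1, e2⟩ := slope_eq_zero_of_mem_MSet hp' hh hlam hu
  have := pos_mul_neg u
  rw [Jlam_eq_energy hp' hh hlam hu.1]
  exact (fiberCoeff a p lam h (pos u) (neg u)).energy_add_gap_le hb hp
    (innerHlam_nonneg_of_disjoint ha.le (pos_nonneg u) (neg_nonpos u) this)
    (dirichlet_self_nonneg _)
    (tsum_nonneg (gradForm_nonneg_of_disjoint (pos_nonneg u) (neg_nonpos u) this))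
    (dirichlet_self_nonneg _) (powSum_nonneg _ _) (powSum_nonneg _ _) e1 e2 hs ht

theorem two_mul_cLam_lt_mLam (ha : 0 < a) (hb : 0 < b) (hp : 4 < p) (hh : ∀ x, 0 ≤ h x)
    (hlam : 0 ≤ lam) : 2 * cLam a b p lam h < mLam a b p lam h := by
  have hp' : 3 ≤ p := by linarith
  have hpp : 0 < 1 / 2 - 1 / p :=
    sub_pos.2 (one_div_lt_one_div_of_lt (by norm_num) (by linarith))
  have hne := (exists_mem_MSet ha hb hp hh hlam).image (Jlam a b p lam h)
  set m := mLam a b p lam h with hm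
  have hm0 : 0 ≤ m := le_csInf hne (by
    rintro _ ⟨v, hv, rfl⟩
    exact Jlam_nonneg_of_mem_NSet ha hb hp hh hlam (MSet_subset_NSet hp' hh hlam hv))
  set K := (m + 1) / (1 / 2 - 1 / p) with hK
  have hKpos : 0 < K := by positivity
  have hKm : (1 / 2 - 1 / p) * K = m + 1 := by rw [hK, mul_div_cancel₀ _ hpp.ne']
  set κ := 1 / (8 * K) with hκ
  have hκpos : 0 < κ := by positivity
  have hδ : 0 < min 1 (b / 4 * κ ^ 2) := lt_min one_pos (by positivity)
  obtain ⟨_, ⟨u, hu, rfl⟩, hlt⟩ := exists_lt_of_csInf_lt hne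
    (show sInf (Jlam a b p lam h '' MSet a b p lam h) < m + min 1 (b / 4 * κ ^ 2) by
      rw [hm, mLam] at *; linarith)
  have hv := hu.1.pos hh
  have hw := hu.1.neg hh
  obtain ⟨s, hs, hsN⟩ := exists_smul_mem_NSet ha hb hp hh hlam hv hu.2.1
  obtain ⟨t, ht, htN⟩ := exists_smul_mem_NSet ha hb hp hh hlam hw hu.2.2.1
  have h1 := Jlam_comb_le_of_mem_MSet ha hb hp hh hlam hu hs ht
  rw [← Jlam_comb hp' hh hlam hv hw (pos_mul_neg u) hs ht] at h1
  have hgap : ∀ r : ℝ, 0 < r → 0 ≤ (1 - r ^ 2) / 2 - (1 - r ^ p) / p := fun r hr => by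
    simpa using rpow_bernoulli_gap (q := 2) two_pos (by linarith : (2:ℝ) ≤ p) hr
  have h2 := mul_nonneg (innerHlam_self_pos ha.le hh hlam hv hu.2.1).le (hgap s hs)
  have h3 := mul_nonneg (innerHlam_self_pos ha.le hh hlam hw hu.2.2.1).le (hgap t ht)
  have h4 := Jlam_add_le ha hb hp' hh hlam hsN.1 htN.1
    (fun x => mul_nonneg hs.le (pos_nonneg u x))
    (fun x => mul_nonpos_of_nonneg_of_nonpos ht.le (neg_nonpos u x))
    (fun x => by
      simp only [Pi.smul_apply, smul_eq_mul]
      linear_combination s * t * pos_mul_neg u x)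
  have j1 := Jlam_nonneg_of_mem_NSet ha hb hp hh hlam hsN
  have j2 := Jlam_nonneg_of_mem_NSet ha hb hp hh hlam htN
  have c1 := cLam_le ha hb hp hh hlam hsN
  have c2 := cLam_le ha hb hp hh hlam htN
  have d0 : 0 ≤ b / 2 * (dirichlet (s • pos u) (s • pos u) * dirichlet (t • neg u) (t • neg u)) :=
    mul_nonneg (by positivity) (mul_nonneg (dirichlet_self_nonneg _) (dirichlet_self_nonneg _))
  have m1 := min_le_left 1 (b / 4 * κ ^ 2)
  have m2 := min_le_right 1 (b / 4 * κ ^ 2)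
  have d1 := inv_le_dirichlet_of_mem_NSet ha hb hp hh hlam hsN hKpos (by linarith)
  have d2 := inv_le_dirichlet_of_mem_NSet ha hb hp hh hlam htN hKpos (by linarith)
  have d3 := mul_le_mul d1 d2 hκpos.le (dirichlet_self_nonneg _)
  have d4 := mul_le_mul_of_nonneg_left d3 (by positivity : 0 ≤ b / 2)
  have d5 : 0 < b * κ ^ 2 := by positivity
  rw [← hκ] at d4
  linarith

end Space

theorem contDiff_abs_rpow {p : ℝ} (hp : 1 < p) : ContDiff ℝ 1 fun x : ℝ => |x| ^ p :=
  contDiff_norm_rpow (E := ℝ) hp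

theorem continuous_nlTerm {p : ℝ} (hp : 3 ≤ p) : Continuous (nlTerm p) := by
  have : nlTerm p = fun x => |x| ^ (p - 2) * Real.log (x ^ 2) * x := by
    ext x; rw [nlTerm_eq]; ring
  rw [this]
  exact (continuous_rpow_mul_log (by linarith)).mul continuous_id

theorem hasDerivAt_logTerm {p : ℝ} (hp : 3 ≤ p) (x : ℝ) :
    HasDerivAt (logTerm p) (p * nlTerm p x + 2 * (|x| ^ (p - 2) * x)) x := by
  have hne : ∀ y : ℝ, y ≠ 0 →
      HasDerivAt (logTerm p) (p * nlTerm p y + 2 * (|y| ^ (p - 2) * y)) y := fun y hy => by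
    have h1 := (hasDerivAt_abs_rpow y (by linarith : 1 < p)).mul
      ((hasDerivAt_pow 2 y).log (pow_ne_zero 2 hy))
    have h2 : logTerm p = fun x => |x| ^ p * Real.log (x ^ 2) := funext (logTerm_eq p)
    rw [h2]
    refine h1.congr_deriv ?_
    have h3 : |y| ^ p = |y| ^ (p - 2) * y ^ 2 := by
      rw [← sq_abs, ← Real.rpow_natCast, ← Real.rpow_add (abs_pos.2 hy)]; congr 1; push_cast; ring
    rw [nlTerm_eq, h3]; field_simp; norm_num; ring
  rcases eq_or_ne x 0 with rfl | hx
  · refine hasDerivAt_of_hasDerivAt_of_ne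
      (g := fun y => p * nlTerm p y + 2 * (|y| ^ (p - 2) * y)) hne ?_ ?_
    · have h2 : logTerm p = fun x => |x| ^ p * Real.log (x ^ 2) := funext (logTerm_eq p)
      rw [h2]
      exact (continuous_rpow_mul_log (by linarith)).continuousAt
    · have h1 := continuous_nlTerm hp
      have h2 : Continuous fun y : ℝ => |y| ^ (p - 2) :=
        continuous_abs.rpow_const fun _ => Or.inr (by linarith)
      exact Continuous.continuousAt (by fun_prop)
  · exact hne x hx

theorem contDiff_logTerm {p : ℝ} (hp : 3 ≤ p) : ContDiff ℝ 1 (logTerm p) := by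
  refine contDiff_one_iff_deriv.2 ⟨fun x => (hasDerivAt_logTerm hp x).differentiableAt, ?_⟩
  have : deriv (logTerm p) = fun x => p * nlTerm p x + 2 * (|x| ^ (p - 2) * x) :=
    funext fun x => (hasDerivAt_logTerm hp x).deriv
  rw [this]
  have h1 := continuous_nlTerm hp
  have h2 : Continuous fun y : ℝ => |y| ^ (p - 2) :=
    continuous_abs.rpow_const fun _ => Or.inr (by linarith)
  fun_prop

theorem tsum_comp_add_single (F : ℝ → ℝ) {v : V → ℝ} (hv : Summable fun z => F (v z)) (x : V)
    (ε : ℝ) : ∑' z, F ((v + ε • (Pi.single x 1 : V → ℝ)) z)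
      = ∑' z, F (v z) + (F (v x + ε) - F (v x)) := by
  have hs : Summable (Pi.single x (F (v x + ε) - F (v x)) : V → ℝ) :=
    (hasSum_pi_single x _).summable
  rw [← tsum_pi_single x (F (v x + ε) - F (v x)), ← hv.tsum_add hs]
  refine tsum_congr fun z => ?_
  rcases eq_or_ne z x with rfl | hz
  · simp
  · simp [hz]

section Space

variable {h : V → ℝ} {lam a b p : ℝ}

/-- The fibering coefficients of `(v + ε 1ₓ, w)` as an explicit function of `ε`. -/
noncomputable def bumpCoeff (a p lam : ℝ) (h v w : V → ℝ) (x : V) (ε : ℝ) : FiberCoeff where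
  A := innerHlam a lam h v v + 2 * ε * innerHlam a lam h v (Pi.single x 1)
    + ε ^ 2 * innerHlam a lam h (Pi.single x 1) (Pi.single x 1)
  D := innerHlam a lam h v w + ε * innerHlam a lam h w (Pi.single x 1)
  B := innerHlam a lam h w w
  E₁ := dirichlet v v + 2 * ε * dirichlet v (Pi.single x 1)
    + ε ^ 2 * dirichlet (Pi.single x 1) (Pi.single x 1)
  C := dirichlet v w + ε * dirichlet w (Pi.single x 1)
  E₂ := dirichlet w w
  P₁ := powSum p v + (|v x + ε| ^ p - |v x| ^ p)
  L₁ := logSum p v + (logTerm p (v x + ε) - logTerm p (v x))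
  P₂ := powSum p w
  L₂ := logSum p w

theorem fiberCoeff_add_single (hp : 3 ≤ p) (hh : ∀ x, 0 ≤ h x) (hlam : 0 ≤ lam) {v w : V → ℝ}
    (hv : memH h v) (hw : memH h w) (x : V) (ε : ℝ) :
    fiberCoeff a p lam h (v + ε • Pi.single x 1) w = bumpCoeff a p lam h v w x ε := by
  have hδ : memH h (Pi.single x 1) := memH_single x
  have e1 := innerHlam_comb_self (a := a) hh hlam hv hδ 1 ε
  have e2 := dirichlet_comb_self hh hv hδ 1 ε
  have e3 := innerHlam_comb_left a hh hlam hv hδ hw 1 ε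
  have e4 := dirichlet_comb_left hv hδ hw 1 ε
  rw [one_smul] at e1 e2 e3 e4
  rw [innerHlam_comm a (Pi.single x 1)] at e3
  rw [dirichlet_comm (Pi.single x 1)] at e4
  have e5 : powSum p (v + ε • Pi.single x 1) = powSum p v + (|v x + ε| ^ p - |v x| ^ p) :=
    tsum_comp_add_single (fun r => |r| ^ p) (summable_rpow hv.summable_sq (by linarith)) x ε
  have e6 : logSum p (v + ε • Pi.single x 1)
      = logSum p v + (logTerm p (v x + ε) - logTerm p (v x)) :=
    tsum_comp_add_single (logTerm p) (summable_logTerm hv.summable_sq hp) x ε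
  simp only [fiberCoeff, bumpCoeff, e1, e2, e3, e4, e5, e6, FiberCoeff.mk.injEq, true_and,
    and_true]
  refine ⟨?_, ?_, ?_, ?_⟩ <;> ring

theorem contDiffAt_bumpCoeff_energy (hp : 3 ≤ p) (v w : V → ℝ) (x : V) (σ ε s t : ℝ)
    (hs : 0 < s) (ht : 0 < t) :
    ContDiffAt ℝ 1 (fun q : ℝ × ℝ × ℝ =>
      (bumpCoeff a p lam h v w x (σ * q.1)).energy b p q.2.1 q.2.2) (ε, s, t) := by
  have c1 : ContDiffAt ℝ 1 (fun q : ℝ × ℝ × ℝ => q.2.1 ^ p) (ε, s, t) :=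
    ContDiffAt.rpow_const_of_ne (by fun_prop) hs.ne'
  have c2 : ContDiffAt ℝ 1 (fun q : ℝ × ℝ × ℝ => q.2.2 ^ p) (ε, s, t) :=
    ContDiffAt.rpow_const_of_ne (by fun_prop) ht.ne'
  have c3 : ContDiffAt ℝ 1 (fun q : ℝ × ℝ × ℝ => Real.log (q.2.1 ^ 2)) (ε, s, t) :=
    ContDiffAt.log (by fun_prop) (pow_ne_zero 2 hs.ne')
  have c4 : ContDiffAt ℝ 1 (fun q : ℝ × ℝ × ℝ => Real.log (q.2.2 ^ 2)) (ε, s, t) :=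
    ContDiffAt.log (by fun_prop) (pow_ne_zero 2 ht.ne')
  have c5 : ContDiffAt ℝ 1 (fun q : ℝ × ℝ × ℝ => |v x + σ * q.1| ^ p) (ε, s, t) :=
    ((contDiff_abs_rpow (by linarith : 1 < p)).comp
      (by fun_prop : ContDiff ℝ 1 fun q : ℝ × ℝ × ℝ => v x + σ * q.1)).contDiffAt
  have c6 : ContDiffAt ℝ 1 (fun q : ℝ × ℝ × ℝ => logTerm p (v x + σ * q.1)) (ε, s, t) :=
    ((contDiff_logTerm hp).comp
      (by fun_prop : ContDiff ℝ 1 fun q : ℝ × ℝ × ℝ => v x + σ * q.1)).contDiffAt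
  simp only [bumpCoeff, FiberCoeff.energy]
  fun_prop

theorem hasDerivAt_bumpCoeff_energy (hp : 3 ≤ p) (hh : ∀ x, 0 ≤ h x) (hlam : 0 ≤ lam)
    {v w : V → ℝ} (hv : memH h v) (hw : memH h w) {x : V} (hx : w x = 0) :
    HasDerivAt (fun ε => (bumpCoeff a p lam h v w x ε).energy b p 1 1)
      (Jp a b p lam h (v + w) (Pi.single x 1)) 0 := by
  have hδ : memH h (Pi.single x 1) := memH_single x
  have d1 : HasDerivAt (fun ε : ℝ => |v x + ε| ^ p) (p * |v x| ^ (p - 2) * v x) 0 := by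
    have := hasDerivAt_abs_rpow (v x + 0) (by linarith : 1 < p)
    simpa using this.comp_const_add (v x) 0
  have d2 : HasDerivAt (fun ε : ℝ => logTerm p (v x + ε))
      (p * nlTerm p (v x) + 2 * (|v x| ^ (p - 2) * v x)) 0 := by
    have := hasDerivAt_logTerm hp (v x + 0)
    simpa using this.comp_const_add (v x) 0
  have i := hasDerivAt_id (0:ℝ)
  have lin : ∀ c d : ℝ, HasDerivAt (fun ε => c + ε * d) d 0 := fun c d => by
    simpa using (i.mul_const d).const_add c
  have quad : ∀ c d e : ℝ, HasDerivAt (fun ε => c + 2 * ε * d + ε ^ 2 * e) (2 * d) 0 :=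
    fun c d e =>
      ((((i.const_mul 2).mul_const d).const_add c).add ((i.pow 2).mul_const e)).congr_deriv
        (by simp)
  set δ : V → ℝ := Pi.single x 1 with hδdef
  have e1 := innerHlam_comb_left a hh hlam hv hw hδ 1 1
  have e2 := dirichlet_comb_left hv hw hδ 1 1
  have e3 := dirichlet_comb_self hh hv hw 1 1
  rw [one_smul, one_smul] at e1 e2 e3
  have e4 : ∑' z, nlTerm p ((v + w) z) * δ z = nlTerm p (v x) := by
    rw [tsum_eq_single x fun z hz => by simp [hδdef, hz]]
    simp [hδdef, hx]
  rw [Jp_eq, e1, e2, e3, e4]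
  have key := (((((quad (innerHlam a lam h v v) (innerHlam a lam h v δ)
      (innerHlam a lam h δ δ)).add
    ((lin (innerHlam a lam h v w) (innerHlam a lam h w δ)).const_mul 2)).add_const
      (innerHlam a lam h w w)).const_mul (1 / 2)).add
    (((((quad (dirichlet v v) (dirichlet v δ) (dirichlet δ δ)).add
      ((lin (dirichlet v w) (dirichlet w δ)).const_mul 2)).add_const
        (dirichlet w w)).pow 2).const_mul (b / 4))).add
    (((((d1.sub_const (|v x| ^ p)).const_add (powSum p v)).add_const
      (powSum p w)).const_mul (2 / p ^ 2)).sub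
    ((((d2.sub_const (logTerm p (v x))).const_add (logSum p v)).add_const
      (logSum p w)).const_mul (1 / p)))
  have hp0 : p ≠ 0 := by linarith
  refine (key.congr_of_eventuallyEq (Eventually.of_forall fun ε => ?_)).congr_deriv ?_
  · simp only [bumpCoeff, FiberCoeff.energy, Real.one_rpow, one_pow, Real.log_one, Pi.add_apply,
      Pi.sub_apply, Pi.pow_apply]
    ring
  · field_simp
    norm_num
    ring

theorem sign_mul_Jp_single_nonneg (ha : 0 < a) (hb : 0 < b) (hp : 4 < p) (hh : ∀ x, 0 ≤ h x)
    (hlam : 0 ≤ lam) {u : V → ℝ} (hu : u ∈ MSet a b p lam h)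
    (hm : Jlam a b p lam h u = mLam a b p lam h) {x : V} (hx : 0 ≤ u x) {σ : ℝ} (hσ : |σ| = 1)
    (hxσ : 0 < u x ∨ σ = 1) : 0 ≤ σ * Jp a b p lam h u (Pi.single x 1) := by
  by_contra! hneg
  have hp' : 3 ≤ p := by linarith
  have hv := hu.1.pos hh
  have hw := hu.1.neg hh
  have hvx : pos u x = u x := max_eq_left hx
  have hwx : neg u x = 0 := min_eq_right hx
  set k := bumpCoeff a p lam h (pos u) (neg u) x with hk
  have hk0 : k 0 = fiberCoeff a p lam h (pos u) (neg u) := by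
    rw [hk, ← fiberCoeff_add_single hp' hh hlam hv hw, zero_smul, add_zero]
  have hJ : (k 0).energy b p 1 1 = mLam a b p lam h := by
    rw [hk0, ← hm, Jlam_eq_energy hp' hh hlam hu.1]
  have hd : HasDerivAt (fun ε => (k (σ * ε)).energy b p 1 1)
      (σ * Jp a b p lam h u (Pi.single x 1)) 0 := by
    have h1 := hasDerivAt_bumpCoeff_energy (a := a) (b := b) hp' hh hlam hv hw hwx
    rw [pos_add_neg] at h1
    have h2 : HasDerivAt (fun ε : ℝ => σ * ε) σ 0 := by
      simpa using (hasDerivAt_id (0:ℝ)).const_mul σ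
    have h3 := HasDerivAt.comp (0:ℝ) (h₂ := fun ε => (k ε).energy b p 1 1)
      (by rw [mul_zero]; exact h1) h2
    rw [mul_comm]
    exact h3
  have hgap : ∀ r : ℝ, 0 < r → 0 ≤ (1 - r ^ 2) / 2 - (1 - r ^ p) / p := fun r hr => by
    simpa using rpow_bernoulli_gap (q := 2) two_pos (by linarith : (2:ℝ) ≤ p) hr
  have hgap' : ∀ r : ℝ, 0 < r → r ≠ 1 → 0 < (1 - r ^ 2) / 2 - (1 - r ^ p) / p :=
    fun r hr h1 => by
      simpa using rpow_bernoulli_gap_pos (q := 2) two_pos (by linarith : (2:ℝ) < p) hr h1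
  have hA := innerHlam_self_pos ha.le hh hlam hv hu.2.1
  have hB := innerHlam_self_pos ha.le hh hlam hw hu.2.2.1
  obtain ⟨ε, s, t, hε, hερ, hs, ht, hloc, hlt⟩ := exists_perturbed_localMax
    (Γ := fun q => (k (σ * q.1)).energy b p q.2.1 q.2.2)
    (fun ε s t hs ht => contDiffAt_bumpCoeff_energy hp' _ _ x σ ε s t hs ht) hd hneg
    (fun s t hs ht hst => by
      have h1 := Jlam_comb_le_of_mem_MSet ha hb hp hh hlam hu hs ht
      simp only [mul_zero]
      rw [hJ, hk0, ← hm]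
      rcases eq_or_ne s 1 with h2 | h2
      · have h3 : t ≠ 1 := fun h3 => hst (by rw [h2, h3])
        have h4 := mul_nonneg hA.le (hgap s hs)
        have h5 := mul_pos hB (hgap' t ht h3)
        linarith
      · have h4 := mul_pos hA (hgap' s hs h2)
        have h5 := mul_nonneg hB.le (hgap t ht)
        linarith)
    (ρ := if 0 < u x then u x else 1) (by split_ifs with h0; exacts [h0, one_pos])
  have hpos : 0 < u x + σ * ε := by
    have hσ1 := (abs_le.1 hσ.le).1
    rcases hxσ with h1 | h1
    · rw [if_pos h1] at hερ
      nlinarith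
    · rw [h1]; linarith
  simp only [mul_zero] at hlt
  rw [hJ, hk, ← fiberCoeff_add_single hp' hh hlam hv hw] at hlt
  have hloc' : IsLocalMax (fun q : ℝ × ℝ => (k (σ * ε)).energy b p q.1 q.2) (s, t) := hloc
  obtain ⟨s1, s2⟩ := (k (σ * ε)).slope_eq_zero_of_isLocalMax (by linarith) hs ht hloc'
  rw [hk, ← fiberCoeff_add_single hp' hh hlam hv hw] at s1 s2
  set v' := pos u + (σ * ε) • (Pi.single x 1 : V → ℝ) with hv'
  have hval : v' x = u x + σ * ε := by simp [hv', hvx]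
  have hvalne : ∀ z, z ≠ x → v' z = pos u z := fun z hz => by simp [hv', hz]
  have hv'H : memH h v' := by
    simpa using hv.comb hh (memH_single x) 1 (σ * ε)
  have hv'0 : ∀ z, 0 ≤ v' z := fun z => by
    rcases eq_or_ne z x with rfl | hz
    · rw [hval]; exact hpos.le
    · rw [hvalne z hz]; exact pos_nonneg u z
  have hv'w : ∀ z, v' z * neg u z = 0 := fun z => by
    rcases eq_or_ne z x with rfl | hz
    · rw [hwx, mul_zero]
    · rw [hvalne z hz]; exact pos_mul_neg u z
  have hv'ne : v' ≠ 0 := fun e => by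
    have := congrFun e x
    rw [hval] at this
    exact hpos.ne' this
  have hM := comb_mem_MSet hp' hh hlam hv'H hw hv'0 (neg_nonpos u) hv'w hv'ne hu.2.2.1 hs ht s1 s2
  have hle := mLam_le ha hb hp hh hlam hM
  rw [Jlam_comb hp' hh hlam hv'H hw hv'w hs ht] at hle
  exact hle.not_gt hlt

theorem nlTerm_neg (r : ℝ) : nlTerm p (-r) = -nlTerm p r := by
  rw [nlTerm_eq, nlTerm_eq, abs_neg, neg_sq]; ring

theorem gradForm_neg_left (u v : V → ℝ) (x : V) : gradForm (-u) v x = -gradForm u v x := by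
  simpa using gradForm_comb_left (-1) 0 u u v x

theorem gradForm_neg_right (u v : V → ℝ) (x : V) : gradForm u (-v) x = -gradForm u v x := by
  rw [gradForm_comm, gradForm_neg_left, gradForm_comm]

theorem gradSq_neg (u : V → ℝ) (x : V) : gradSq (-u) x = gradSq u x := by
  rw [gradSq, gradForm_neg_left, gradForm_neg_right, neg_neg, gradSq]

theorem Jp_neg_right (u φ : V → ℝ) : Jp a b p lam h u (-φ) = -Jp a b p lam h u φ := by
  simp only [Jp, gradForm_neg_right, Pi.neg_apply, mul_neg, ← neg_add, tsum_neg]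
  ring

theorem Jp_neg_left (u φ : V → ℝ) : Jp a b p lam h (-u) φ = -Jp a b p lam h u φ := by
  have h1 : ∀ x, a * -gradForm u φ x + hl lam h x * -u x * φ x
      = -(a * gradForm u φ x + hl lam h x * u x * φ x) := fun x => by ring
  simp only [Jp, gradForm_neg_left, gradSq_neg, Pi.neg_apply, nlTerm_neg, h1, neg_mul, tsum_neg]
  ring

theorem Jlam_neg (u : V → ℝ) : Jlam a b p lam h (-u) = Jlam a b p lam h u := by
  simp only [Jlam, normHlamSq, gradSq_neg, Pi.neg_apply, neg_sq, abs_neg, logTerm_eq]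

theorem neg_mem_MSet (hh : ∀ x, 0 ≤ h x) {u : V → ℝ} (hu : u ∈ MSet a b p lam h) :
    -u ∈ MSet a b p lam h := by
  obtain ⟨h1, h2, h3, h4, h5⟩ := hu
  refine ⟨h1.neg' hh, ?_, ?_, ?_, ?_⟩
  · rwa [pos_neg, neg_ne_zero]
  · rwa [neg_neg', neg_ne_zero]
  · rw [pos_neg, Jp_neg_left, Jp_neg_right, h5, neg_zero, neg_zero]
  · rw [neg_neg', Jp_neg_left, Jp_neg_right, h4, neg_zero, neg_zero]

/-- Minimizers on the sign-changing Nehari set are critical points. -/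
theorem Jp_single_eq_zero (ha : 0 < a) (hb : 0 < b) (hp : 4 < p) (hh : ∀ x, 0 ≤ h x)
    (hlam : 0 ≤ lam) {u : V → ℝ} (hu : u ∈ MSet a b p lam h)
    (hm : Jlam a b p lam h u = mLam a b p lam h) (x : V) :
    Jp a b p lam h u (Pi.single x 1) = 0 := by
  have hu' := neg_mem_MSet hh hu
  have hm' : Jlam a b p lam h (-u) = mLam a b p lam h := by rw [Jlam_neg, hm]
  have hn : (-u) x = -u x := rfl
  rcases lt_trichotomy (u x) 0 with h0 | h0 | h0
  · have h1 := sign_mul_Jp_single_nonneg ha hb hp hh hlam hu' hm' (x := x) (σ := 1)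
      (by rw [hn]; linarith) (by simp) (Or.inr rfl)
    have h2 := sign_mul_Jp_single_nonneg ha hb hp hh hlam hu' hm' (x := x) (σ := -1)
      (by rw [hn]; linarith) (by simp) (Or.inl (by rw [hn]; linarith))
    rw [Jp_neg_left] at h1 h2
    linarith
  · have h1 := sign_mul_Jp_single_nonneg ha hb hp hh hlam hu hm (x := x) (σ := 1)
      h0.ge (by simp) (Or.inr rfl)
    have h2 := sign_mul_Jp_single_nonneg ha hb hp hh hlam hu' hm' (x := x) (σ := 1)
      (by rw [hn]; linarith) (by simp) (Or.inr rfl)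
    rw [Jp_neg_left] at h2
    linarith
  · have h1 := sign_mul_Jp_single_nonneg ha hb hp hh hlam hu hm (x := x) (σ := 1)
      h0.le (by simp) (Or.inr rfl)
    have h2 := sign_mul_Jp_single_nonneg ha hb hp hh hlam hu hm (x := x) (σ := -1)
      h0.le (by simp) (Or.inl h0)
    linarith

theorem Jp_single (hh : ∀ x, 0 ≤ h x) (hlam : 0 ≤ lam) {u : V → ℝ} (hu : memH h u) (x : V) :
    Jp a b p lam h u (Pi.single x 1)
      = -(a + b * ∑' y, gradSq u y) * lap u x + hl lam h x * u x - nlTerm p (u x) := by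
  have h1 : ∑' z, hl lam h z * u z * (Pi.single x 1 : V → ℝ) z = hl lam h x * u x := by
    rw [tsum_eq_single x fun z hz => by simp [hz]]; simp
  have h2 : ∑' z, nlTerm p (u z) * (Pi.single x 1 : V → ℝ) z = nlTerm p (u x) := by
    rw [tsum_eq_single x fun z hz => by simp [hz]]; simp
  rw [Jp_eq, innerHlam_eq a hh hlam hu (memH_single x), h1, h2, dirichlet_single]
  change _ + _ + b * (∑' y, gradSq u y) * _ - _ = _
  ring

theorem solvesEq_of_Jlam_eq_mLam (ha : 0 < a) (hb : 0 < b) (hp : 4 < p) (hh : ∀ x, 0 ≤ h x)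
    (hlam : 0 ≤ lam) {u : V → ℝ} (hu : u ∈ MSet a b p lam h)
    (hm : Jlam a b p lam h u = mLam a b p lam h) : solvesEq a b p lam h u := fun x =>
  sub_eq_zero.1 ((Jp_single hh hlam hu.1 x).symm.trans
    (Jp_single_eq_zero ha hb hp hh hlam hu hm x))

end Space

/-- minimizers of J_λ on M_λ are sign-changing solutions, and m_λ > 2c_λ. -/
theorem stmt16 (a b p : ℝ) (ha : 0 < a) (hb : 0 < b) (hp : 6 < p)
    (h : V → ℝ) (hh1 : hypH1 h) (hh2 : hypH2 h) :
    ∃ lam₀ > (0:ℝ), ∀ lam ≥ lam₀,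
      (∀ u ∈ MSet a b p lam h,
        Jlam a b p lam h u = mLam a b p lam h → solvesEq a b p lam h u) ∧
      mLam a b p lam h > 2 * cLam a b p lam h := by
  refine ⟨1, one_pos, fun lam hlam => ?_⟩
  have hlam' : 0 ≤ lam := zero_le_one.trans hlam
  exact ⟨fun u hu hm => solvesEq_of_Jlam_eq_mLam ha hb (by linarith) hh1.1 hlam' hu hm,
    two_mul_cLam_lt_mLam ha hb (by linarith) hh1.1 hlam'⟩

end DiscreteKirchhoff
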